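/- arXiv:0808.2108 — 11 statements merged into one kernel-verified Lean document; each statement's English description precedes it below -/
import Mathlib

section
/- For all λ, μ, ν ∈ ℂ the six-vertex R-matrix satisfies the Yang–Baxter equation R₁₂(λ−μ) · R₁₃(λ−ν) · R₂₃(μ−ν) = R₂₃(μ−ν) · R₁₃(λ−ν) · R₁₂(λ−μ) as an identity of endomorphisms of ℂ² ⊗ ℂ² ⊗ ℂ², where R_{ij}(λ) acts as R(λ) on the i-th and j-th tensor factors and as the identity on the remaining factor. -/
open Complex Matrix

/-- The six-vertex `R`-matrix on `ℂ² ⊗ ℂ²`, in the ordered basis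
`e₁⊗e₁, e₁⊗e₂, e₂⊗e₁, e₂⊗e₂` (encoded by pairs in `Fin 2 × Fin 2`). -/
noncomputable def R6v (η lam : ℂ) : Matrix (Fin 2 × Fin 2) (Fin 2 × Fin 2) ℂ :=
  Matrix.of fun p q =>
    if p = q then (if p.1 = p.2 then sinh (lam + η) else sinh lam)
    else if p.1 = q.2 ∧ p.2 = q.1 then sinh η else 0

/-- `R₁₂(λ)`: the `R`-matrix acting on factors 1 and 2 of `ℂ² ⊗ ℂ² ⊗ ℂ²`. -/
noncomputable def R12 (η lam : ℂ) :
    Matrix (Fin 2 × Fin 2 × Fin 2) (Fin 2 × Fin 2 × Fin 2) ℂ :=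
  Matrix.of fun p q =>
    R6v η lam (p.1, p.2.1) (q.1, q.2.1) * (if p.2.2 = q.2.2 then 1 else 0)

/-- `R₁₃(λ)`: the `R`-matrix acting on factors 1 and 3 of `ℂ² ⊗ ℂ² ⊗ ℂ²`. -/
noncomputable def R13 (η lam : ℂ) :
    Matrix (Fin 2 × Fin 2 × Fin 2) (Fin 2 × Fin 2 × Fin 2) ℂ :=
  Matrix.of fun p q =>
    R6v η lam (p.1, p.2.2) (q.1, q.2.2) * (if p.2.1 = q.2.1 then 1 else 0)

/-- `R₂₃(λ)`: the `R`-matrix acting on factors 2 and 3 of `ℂ² ⊗ ℂ² ⊗ ℂ²`. -/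
noncomputable def R23 (η lam : ℂ) :
    Matrix (Fin 2 × Fin 2 × Fin 2) (Fin 2 × Fin 2 × Fin 2) ℂ :=
  Matrix.of fun p q =>
    R6v η lam (p.2.1, p.2.2) (q.2.1, q.2.2) * (if p.1 = q.1 then 1 else 0)

/-- The three-term addition identity behind the Yang–Baxter equation. -/
theorem sinh_add_mul_sinh_add (x y z : ℂ) :
    sinh (x + y) * sinh (x + z) = sinh (x + y + z) * sinh x + sinh y * sinh z := by
  simp only [Complex.sinh_add, Complex.cosh_add]
  linear_combination sinh y * sinh z * Complex.cosh_sq x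

set_option maxHeartbeats 2000000 in
/-- The Yang–Baxter equation for the six-vertex `R`-matrix. -/
theorem yang_baxter_equation (η lam μ ν : ℂ) :
    R12 η (lam - μ) * R13 η (lam - ν) * R23 η (μ - ν) =
      R23 η (μ - ν) * R13 η (lam - ν) * R12 η (lam - μ) := by
  have h₁ := sinh_add_mul_sinh_add (lam - μ) η (μ - ν)
  have h₂ := sinh_add_mul_sinh_add (μ - ν) η (lam - μ)
  have h₃ := sinh_add_mul_sinh_add η (lam - μ) (μ - ν)
  rw [show lam - μ + η + (μ - ν) = lam - ν + η by ring, sub_add_sub_cancel] at h₁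
  rw [show μ - ν + η + (lam - μ) = lam - ν + η by ring, show μ - ν + (lam - μ) = lam - ν by ring] at h₂
  rw [show η + (lam - μ) + (μ - ν) = lam - ν + η by ring, add_comm η, add_comm η] at h₃
  ext ⟨i, j, k⟩ ⟨i', j', k'⟩
  fin_cases i <;> fin_cases j <;> fin_cases k <;> fin_cases i' <;> fin_cases j' <;>
    fin_cases k' <;>
    simp [Matrix.mul_apply, Fintype.sum_prod_type, R12, R13, R23, R6v]
  all_goals first
    | ring1
    | linear_combination sinh η * h₁
    | linear_combination -sinh η * h₁
    | linear_combination sinh η * h₂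
    | linear_combination -sinh η * h₂
    | linear_combination sinh η * h₃
    | linear_combination -sinh η * h₃
end

section
/- Define the partial transpose R^{t₁}(λ) of the six-vertex R-matrix in the first tensor factor entrywise by (R^{t₁}(λ))_{(a,b),(c,d)} = (R(λ))_{(c,b),(a,d)} for a,b,c,d ∈ {1,2}. Then for all λ ∈ ℂ the crossing-unitarity relation holds: R^{t₁}(λ) · R^{t₁}(−λ−2η) = sinh(−λ) · sinh(λ+2η) · id on ℂ² ⊗ ℂ². -/
open Complex Matrix

/-- The partial transpose in the first tensor factor:
`(R^{t₁}(λ))_{(a,b),(c,d)} = (R(λ))_{(c,b),(a,d)}`. -/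
noncomputable def R6vT1 (η lam : ℂ) : Matrix (Fin 2 × Fin 2) (Fin 2 × Fin 2) ℂ :=
  Matrix.of fun p q => R6v η lam (q.1, p.2) (p.1, q.2)

/-- The product formula `sinh (y - x) * sinh (x + y) = sinh² y - sinh² x`. -/
theorem sinh_sub_mul_sinh_add (x y : ℂ) :
    sinh (y - x) * sinh (x + y) = sinh y ^ 2 - sinh x ^ 2 := by
  rw [Complex.sinh_sub, Complex.sinh_add]
  linear_combination sinh y ^ 2 * Complex.cosh_sq x - sinh x ^ 2 * Complex.cosh_sq y

/-- Crossing unitarity of the six-vertex `R`-matrix: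
`R^{t₁}(λ) · R^{t₁}(−λ−2η) = sinh(−λ) · sinh(λ+2η) · id`. -/
theorem R_crossing_unitarity (η lam : ℂ) :
    R6vT1 η lam * R6vT1 η (-lam - 2 * η) =
      (sinh (-lam) * sinh (lam + 2 * η)) • (1 : Matrix (Fin 2 × Fin 2) (Fin 2 × Fin 2) ℂ) := by
  have shift : sinh (-lam - 2 * η + η) = -sinh (lam + η) := by
    rw [← Complex.sinh_neg]
    ring_nf
  have reflect : sinh (-lam - 2 * η) = -sinh (lam + 2 * η) := by
    rw [← Complex.sinh_neg]
    ring_nf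
  have diag : sinh lam * sinh (lam + 2 * η) = sinh (lam + η) ^ 2 - sinh η ^ 2 := by
    rw [← sinh_sub_mul_sinh_add]
    ring_nf
  ext ⟨a, b⟩ ⟨c, d⟩
  fin_cases a <;> fin_cases b <;> fin_cases c <;> fin_cases d <;>
    simp [R6vT1, R6v, Matrix.mul_apply, Fintype.sum_prod_type, shift, reflect] <;>
    first
      | ring1
      | linear_combination diag
end

section
/- For all λ, μ, ξ ∈ ℂ with sinh ξ ≠ 0, cosh λ ≠ 0 and cosh μ ≠ 0, the boundary matrix K(λ,ξ) satisfies the left reflection equation R₁₂(λ−μ) · K₁(λ) · R₁₂(λ+μ) · K₂(μ) = K₂(μ) · R₁₂(λ+μ) · K₁(λ) · R₁₂(λ−μ) on ℂ² ⊗ ℂ², where K₁(λ) = K(λ,ξ) ⊗ I₂, K₂(μ) = I₂ ⊗ K(μ,ξ), and R₁₂(λ) = R(λ); i.e. K(·,ξ) is a c-number representation of the left reflection algebra. -/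
open Complex Matrix
open scoped Kronecker

/-- The diagonal boundary matrix
`K(λ,ξ) = (1/(sinh ξ · cosh λ)) · diag(sinh(λ+ξ), −sinh(λ−ξ))`. -/
noncomputable def Kbdry (ξ lam : ℂ) : Matrix (Fin 2) (Fin 2) ℂ :=
  (1 / (sinh ξ * cosh lam)) •
    Matrix.diagonal (fun i => if i = 0 then sinh (lam + ξ) else -sinh (lam - ξ))

/-- The functional identity for the entries of `K` behind the reflection equation. -/
lemma sinh_reflection_identity (ξ lam μ : ℂ) :
    sinh (lam - μ) * (sinh (lam + ξ) * sinh (μ + ξ) - sinh (lam - ξ) * sinh (μ - ξ)) =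
      sinh (lam + μ) * (sinh (lam - ξ) * sinh (μ + ξ) - sinh (lam + ξ) * sinh (μ - ξ)) := by
  simp only [sinh_add, sinh_sub]
  ring

/-- `K(·,ξ)` is a c-number representation of the left reflection algebra:
the left reflection equation holds on `ℂ² ⊗ ℂ²`. -/
theorem K_left_reflection (η ξ lam μ : ℂ) (hξ : sinh ξ ≠ 0)
    (hlam : cosh lam ≠ 0) (hμ : cosh μ ≠ 0) :
    R6v η (lam - μ) * (Kbdry ξ lam ⊗ₖ (1 : Matrix (Fin 2) (Fin 2) ℂ)) *
        R6v η (lam + μ) * ((1 : Matrix (Fin 2) (Fin 2) ℂ) ⊗ₖ Kbdry ξ μ) =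
      ((1 : Matrix (Fin 2) (Fin 2) ℂ) ⊗ₖ Kbdry ξ μ) * R6v η (lam + μ) *
        (Kbdry ξ lam ⊗ₖ (1 : Matrix (Fin 2) (Fin 2) ℂ)) * R6v η (lam - μ) := by
  have h := sinh_reflection_identity ξ lam μ
  ext ⟨i, j⟩ ⟨k, l⟩
  fin_cases i <;> fin_cases j <;> fin_cases k <;> fin_cases l <;>
    simp [R6v, Kbdry, Matrix.mul_apply, Fintype.sum_prod_type, Matrix.one_apply,
      Matrix.diagonal_apply] <;>
    first
    | ring1
    | linear_combination (norm := ring1)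
        sinh η * (sinh ξ)⁻¹ ^ 2 * (cosh lam)⁻¹ * (cosh μ)⁻¹ * h
    | linear_combination (norm := ring1)
        -(sinh η * (sinh ξ)⁻¹ ^ 2 * (cosh lam)⁻¹ * (cosh μ)⁻¹) * h
end

section
/- Fix ξ⁺ ∈ ℂ with sinh ξ⁺ ≠ 0 and set K⁺(λ) = ½ · K(λ+η, ξ⁺). For all λ, μ ∈ ℂ with cosh(λ+η) ≠ 0 and cosh(μ+η) ≠ 0, the right reflection algebra relation holds: R₁₂(−λ+μ) · K₁⁺(λ) · R₁₂(−λ−μ−2η) · K₂⁺(μ) = K₂⁺(μ) · R₁₂(−λ−μ−2η) · K₁⁺(λ) · R₁₂(−λ+μ) on ℂ² ⊗ ℂ², where K₁⁺(λ) = K⁺(λ) ⊗ I₂ and K₂⁺(μ) = I₂ ⊗ K⁺(μ) (the transpositions occurring in the general right reflection algebra relation are trivial here since K⁺ is diagonal); i.e. K⁺ is a c-number representation of the right reflection algebra. -/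
open Complex Matrix
open scoped Kronecker

/-- The right boundary matrix `K⁺(λ) = ½ · K(λ+η, ξ⁺)`. -/
noncomputable def Kplus (η ξp lam : ℂ) : Matrix (Fin 2) (Fin 2) ℂ :=
  (2 : ℂ)⁻¹ • Kbdry ξp (lam + η)

/-- The scalar identity behind the off-diagonal entries of the right reflection relation. -/
theorem sinh_boundary_exchange (ξ l m : ℂ) :
    sinh (m + ξ) * (sinh (m - l) * sinh (l + ξ) - sinh (-l - m) * sinh (l - ξ)) =
      -sinh (m - ξ) * (sinh (-l - m) * sinh (l + ξ) - sinh (m - l) * sinh (l - ξ)) := by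
  simp only [sub_eq_add_neg, sinh_add, sinh_neg, cosh_neg]
  ring

/-- `K⁺` is a c-number representation of the right reflection algebra. -/
theorem K_right_reflection (η ξp lam μ : ℂ) (hξ : sinh ξp ≠ 0)
    (hlam : cosh (lam + η) ≠ 0) (hμ : cosh (μ + η) ≠ 0) :
    R6v η (-lam + μ) * (Kplus η ξp lam ⊗ₖ (1 : Matrix (Fin 2) (Fin 2) ℂ)) *
        R6v η (-lam - μ - 2 * η) * ((1 : Matrix (Fin 2) (Fin 2) ℂ) ⊗ₖ Kplus η ξp μ) =
      ((1 : Matrix (Fin 2) (Fin 2) ℂ) ⊗ₖ Kplus η ξp μ) * R6v η (-lam - μ - 2 * η) *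
        (Kplus η ξp lam ⊗ₖ (1 : Matrix (Fin 2) (Fin 2) ℂ)) * R6v η (-lam + μ) := by
  have hu : -lam + μ = (μ + η) - (lam + η) := by ring
  have hv : -lam - μ - 2 * η = -(lam + η) - (μ + η) := by ring
  have key := sinh_boundary_exchange ξp (lam + η) (μ + η)
  rw [hu, hv]
  unfold Kplus Kbdry
  generalize lam + η = l at *
  generalize μ + η = m at *
  generalize 1 / (sinh ξp * cosh l) = a
  generalize 1 / (sinh ξp * cosh m) = b
  ext ⟨i, j⟩ ⟨i', j'⟩
  fin_cases i <;> fin_cases j <;> fin_cases i' <;> fin_cases j' <;>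
    simp [R6v, Matrix.mul_apply, Fintype.sum_prod_type, Fin.sum_univ_two, Matrix.one_apply,
      Matrix.diagonal_apply] <;>
    first
      | ring1
      | linear_combination (2⁻¹ * a * (2⁻¹ * b) * sinh η) * key
      | linear_combination -(2⁻¹ * a * (2⁻¹ * b) * sinh η) * key
end

section
/- Let 𝒜 be a unital associative ℂ-algebra and let T : ℂ → M₂(𝒜) satisfy the Yang–Baxter algebra relation with T(λ) invertible in M₂(𝒜) for every λ ∈ ℂ. Fix ξ⁻ ∈ ℂ with sinh ξ⁻ ≠ 0 and define 𝒯⁻(λ) = T(λ) · K(λ,ξ⁻) · T(−λ)⁻¹, the scalar matrix K(λ,ξ⁻) being regarded in M₂(𝒜) via the algebra map ℂ → 𝒜. Then for all λ, μ ∈ ℂ with cosh λ ≠ 0 and cosh μ ≠ 0, 𝒯⁻ satisfies the left reflection algebra relation: R₁₂(λ−μ) · 𝒯₁⁻(λ) · R₁₂(λ+μ) · 𝒯₂⁻(μ) = 𝒯₂⁻(μ) · R₁₂(λ+μ) · 𝒯₁⁻(λ) · R₁₂(λ−μ) in M₄(𝒜), where 𝒯₁⁻ = 𝒯⁻ ⊗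 I₂ and 𝒯₂⁻ = I₂ ⊗ 𝒯⁻ are Kronecker products. -/
open Complex Matrix
open scoped Kronecker

/-- The representation `𝒯⁻(λ) = T(λ) · K(λ,ξ⁻) · T(−λ)⁻¹` of the left reflection
algebra, the scalar matrix `K(λ,ξ⁻)` being regarded in `M₂(𝒜)` via the algebra map. -/
noncomputable def Tminus {A : Type*} [Ring A] [Algebra ℂ A] (ξm : ℂ)
    (T : ℂ → Matrix (Fin 2) (Fin 2) A) (z : ℂ) : Matrix (Fin 2) (Fin 2) A :=
  T z * (Kbdry ξm z).map (algebraMap ℂ A) * Ring.inverse (T (-z))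

section Kronecker

variable {A : Type*} [Ring A]

/-- Left leg embedding `M ↦ M ⊗ 1`, multiplicative even over a noncommutative ring. -/
theorem mul_kronecker_one (M N : Matrix (Fin 2) (Fin 2) A) :
    (M * N) ⊗ₖ (1 : Matrix (Fin 2) (Fin 2) A) = (M ⊗ₖ 1) * (N ⊗ₖ 1) := by
  ext ⟨i, j⟩ ⟨k, l⟩
  simp only [kroneckerMap_apply, mul_apply, Fintype.sum_prod_type, Fin.sum_univ_two]
  fin_cases j <;> fin_cases l <;> simp [one_apply]

/-- Right leg embedding `M ↦ 1 ⊗ M`, multiplicative even over a noncommutative ring. -/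
theorem one_kronecker_mul (M N : Matrix (Fin 2) (Fin 2) A) :
    (1 : Matrix (Fin 2) (Fin 2) A) ⊗ₖ (M * N) = (1 ⊗ₖ M) * (1 ⊗ₖ N) := by
  ext ⟨i, j⟩ ⟨k, l⟩
  simp only [kroneckerMap_apply, mul_apply, Fintype.sum_prod_type, Fin.sum_univ_two]
  fin_cases i <;> fin_cases k <;> simp [one_apply]

theorem kronecker_one_submatrix_swap (M : Matrix (Fin 2) (Fin 2) A) :
    (M ⊗ₖ (1 : Matrix (Fin 2) (Fin 2) A)).submatrix (Equiv.prodComm _ _) (Equiv.prodComm _ _) =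
      1 ⊗ₖ M := by
  ext ⟨i, j⟩ ⟨k, l⟩
  simp [one_apply]

theorem one_kronecker_submatrix_swap (M : Matrix (Fin 2) (Fin 2) A) :
    ((1 : Matrix (Fin 2) (Fin 2) A) ⊗ₖ M).submatrix (Equiv.prodComm _ _) (Equiv.prodComm _ _) =
      M ⊗ₖ 1 := by
  ext ⟨i, j⟩ ⟨k, l⟩
  simp [one_apply]

variable [Algebra ℂ A]

theorem commute_scalar_kronecker_one (K : Matrix (Fin 2) (Fin 2) ℂ)
    (M : Matrix (Fin 2) (Fin 2) A) :
    Commute (K.map (algebraMap ℂ A) ⊗ₖ (1 : Matrix (Fin 2) (Fin 2) A)) (1 ⊗ₖ M) := by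
  ext ⟨i, j⟩ ⟨k, l⟩
  simp only [kroneckerMap_apply, mul_apply, Fintype.sum_prod_type, map_apply, one_apply,
    mul_ite, mul_one, mul_zero, ite_mul, one_mul, zero_mul, Finset.sum_ite_eq,
    Finset.sum_ite_eq', Finset.sum_ite_irrel, Finset.sum_const_zero, Finset.mem_univ, if_true]
  exact Algebra.commutes _ _

theorem commute_kronecker_scalar (K : Matrix (Fin 2) (Fin 2) ℂ) (M : Matrix (Fin 2) (Fin 2) A) :
    Commute ((1 : Matrix (Fin 2) (Fin 2) A) ⊗ₖ K.map (algebraMap ℂ A)) (M ⊗ₖ 1) := by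
  rw [commute_iff_eq]
  have h := congrArg (fun X => X.submatrix (Equiv.prodComm (Fin 2) (Fin 2))
    (Equiv.prodComm (Fin 2) (Fin 2))) (commute_scalar_kronecker_one K M).eq
  simpa only [← submatrix_mul_equiv _ _ _ (Equiv.prodComm (Fin 2) (Fin 2)),
    kronecker_one_submatrix_swap, one_kronecker_submatrix_swap] using h

theorem R6v_submatrix_swap (η z : ℂ) :
    ((R6v η z).map (algebraMap ℂ A)).submatrix (Equiv.prodComm _ _) (Equiv.prodComm _ _) =
      (R6v η z).map (algebraMap ℂ A) := by
  ext ⟨i, j⟩ ⟨k, l⟩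
  fin_cases i <;> fin_cases j <;> fin_cases k <;> fin_cases l <;> simp [R6v]

/-- The Yang–Baxter relation with the two tensor factors exchanged. -/
theorem yangBaxter_swap {η z : ℂ} {M N : Matrix (Fin 2) (Fin 2) A}
    (h : (R6v η z).map (algebraMap ℂ A) * (M ⊗ₖ (1 : Matrix (Fin 2) (Fin 2) A)) * (1 ⊗ₖ N) =
      (1 ⊗ₖ N) * (M ⊗ₖ (1 : Matrix (Fin 2) (Fin 2) A)) * (R6v η z).map (algebraMap ℂ A)) :
    (R6v η z).map (algebraMap ℂ A) * ((1 : Matrix (Fin 2) (Fin 2) A) ⊗ₖ M) * (N ⊗ₖ 1) =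
      (N ⊗ₖ 1) * ((1 : Matrix (Fin 2) (Fin 2) A) ⊗ₖ M) * (R6v η z).map (algebraMap ℂ A) := by
  have h' := congrArg (fun X => X.submatrix (Equiv.prodComm (Fin 2) (Fin 2))
    (Equiv.prodComm (Fin 2) (Fin 2))) h
  simpa only [← submatrix_mul_equiv _ _ _ (Equiv.prodComm (Fin 2) (Fin 2)),
    kronecker_one_submatrix_swap, one_kronecker_submatrix_swap, R6v_submatrix_swap] using h'

end Kronecker

/-- The reflection equation for the diagonal boundary matrix. -/
theorem Kbdry_reflection (η ξ lam μ : ℂ) :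
    R6v η (lam - μ) * (Kbdry ξ lam ⊗ₖ (1 : Matrix (Fin 2) (Fin 2) ℂ)) * R6v η (lam + μ) *
        ((1 : Matrix (Fin 2) (Fin 2) ℂ) ⊗ₖ Kbdry ξ μ) =
      ((1 : Matrix (Fin 2) (Fin 2) ℂ) ⊗ₖ Kbdry ξ μ) * R6v η (lam + μ) *
        (Kbdry ξ lam ⊗ₖ (1 : Matrix (Fin 2) (Fin 2) ℂ)) * R6v η (lam - μ) := by
  unfold Kbdry
  generalize 1 / (sinh ξ * cosh lam) = a
  generalize 1 / (sinh ξ * cosh μ) = b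
  simp only [smul_kronecker, kronecker_smul, Matrix.mul_smul, Matrix.smul_mul]
  rw [smul_comm a b]
  congr 2
  rw [← diagonal_one, diagonal_kronecker_diagonal, diagonal_kronecker_diagonal]
  ext ⟨i, j⟩ ⟨k, l⟩
  rw [mul_diagonal, mul_apply, mul_apply]
  simp only [mul_diagonal, diagonal_mul, Fintype.sum_prod_type, Fin.sum_univ_two]
  fin_cases i <;> fin_cases j <;> fin_cases k <;> fin_cases l <;>
    simp [R6v] <;>
    first
    | ring1
    | simp only [sinh_add, sinh_sub]; ring1

/-- Dressing a solution of the reflection equation: `r`, `s` play the roles of `R(λ-μ)`, `R(λ+μ)`,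
`a`, `a'` of `T₁(±λ)`, `b`, `b'` of `T₂(±μ)`, and `k`, `l` of the boundary matrices. -/
theorem reflection_of_dressing {M : Type*} [Monoid M] {r s k l a b : M} {a' b' : Mˣ}
    (hkl : r * k * s * l = l * s * k * r) (hab : r * a * b = b * a * r)
    (hab' : s * a * b' = b' * a * s) (hba' : s * b * a' = a' * b * s)
    (hba : r * b' * a' = a' * b' * r) (hkb : Commute k b) (hkb' : Commute k b')
    (hla : Commute l a) (hla' : Commute l a') :
    r * (a * k * ↑a'⁻¹) * s * (b * l * ↑b'⁻¹) = b * l * ↑b'⁻¹ * s * (a * k * ↑a'⁻¹) * r := by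
  have e₁ : ↑a'⁻¹ * s * b = b * s * ↑a'⁻¹ := by
    rw [Units.eq_mul_inv_iff_mul_eq, mul_assoc, mul_assoc, Units.inv_mul_eq_iff_eq_mul,
      ← mul_assoc, ← mul_assoc, hba']
  have e₂ : a * s * ↑b'⁻¹ = ↑b'⁻¹ * s * a := by
    rw [Units.mul_inv_eq_iff_eq_mul, mul_assoc, mul_assoc, Units.eq_inv_mul_iff_mul_eq,
      ← mul_assoc, ← mul_assoc, hab']
  have e₃ : r * ↑a'⁻¹ * ↑b'⁻¹ = ↑b'⁻¹ * ↑a'⁻¹ * r := by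
    rw [Units.mul_inv_eq_iff_eq_mul, Units.mul_inv_eq_iff_eq_mul]
    simp only [mul_assoc]
    rw [Units.eq_inv_mul_iff_mul_eq, Units.eq_inv_mul_iff_mul_eq]
    simpa only [mul_assoc] using hba.symm
  have c₁ := hla'.units_inv_right.eq
  have c₂ := hkb'.units_inv_right.eq
  calc r * (a * k * ↑a'⁻¹) * s * (b * l * ↑b'⁻¹)
      = r * a * k * (↑a'⁻¹ * s * b) * l * ↑b'⁻¹ := by simp only [mul_assoc]
    _ = r * a * (k * b) * s * (↑a'⁻¹ * l) * ↑b'⁻¹ := by rw [e₁]; simp only [mul_assoc]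
    _ = (r * a * b) * k * s * l * ↑a'⁻¹ * ↑b'⁻¹ := by rw [hkb.eq, ← c₁]; simp only [mul_assoc]
    _ = b * a * (r * k * s * l) * ↑a'⁻¹ * ↑b'⁻¹ := by rw [hab]; simp only [mul_assoc]
    _ = b * (a * l) * s * k * (r * ↑a'⁻¹ * ↑b'⁻¹) := by rw [hkl]; simp only [mul_assoc]
    _ = b * l * a * s * (k * ↑b'⁻¹) * ↑a'⁻¹ * r := by rw [← hla.eq, e₃]; simp only [mul_assoc]
    _ = b * l * (a * s * ↑b'⁻¹) * k * ↑a'⁻¹ * r := by rw [c₂]; simp only [mul_assoc]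
    _ = _ := by rw [e₂]; simp only [mul_assoc]

/-- If `T` satisfies the Yang–Baxter algebra relation with invertible values, then
`𝒯⁻(λ) = T(λ)·K(λ,ξ⁻)·T(−λ)⁻¹` satisfies the left reflection algebra relation. -/
theorem Tminus_left_reflection {A : Type*} [Ring A] [Algebra ℂ A] (η ξm : ℂ)
    (hξ : sinh ξm ≠ 0) (T : ℂ → Matrix (Fin 2) (Fin 2) A)
    (hYBA : ∀ lam μ : ℂ,
      (R6v η (lam - μ)).map (algebraMap ℂ A) *
          (T lam ⊗ₖ (1 : Matrix (Fin 2) (Fin 2) A)) *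
          ((1 : Matrix (Fin 2) (Fin 2) A) ⊗ₖ T μ) =
        ((1 : Matrix (Fin 2) (Fin 2) A) ⊗ₖ T μ) *
          (T lam ⊗ₖ (1 : Matrix (Fin 2) (Fin 2) A)) *
          (R6v η (lam - μ)).map (algebraMap ℂ A))
    (hinv : ∀ lam : ℂ, IsUnit (T lam))
    (lam μ : ℂ) (hlam : cosh lam ≠ 0) (hμ : cosh μ ≠ 0) :
    (R6v η (lam - μ)).map (algebraMap ℂ A) *
        (Tminus ξm T lam ⊗ₖ (1 : Matrix (Fin 2) (Fin 2) A)) *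
        (R6v η (lam + μ)).map (algebraMap ℂ A) *
        ((1 : Matrix (Fin 2) (Fin 2) A) ⊗ₖ Tminus ξm T μ) =
      ((1 : Matrix (Fin 2) (Fin 2) A) ⊗ₖ Tminus ξm T μ) *
        (R6v η (lam + μ)).map (algebraMap ℂ A) *
        (Tminus ξm T lam ⊗ₖ (1 : Matrix (Fin 2) (Fin 2) A)) *
        (R6v η (lam - μ)).map (algebraMap ℂ A) := by
  have scalar_left (K : Matrix (Fin 2) (Fin 2) ℂ) :
      (K ⊗ₖ (1 : Matrix (Fin 2) (Fin 2) ℂ)).map (algebraMap ℂ A) =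
        K.map (algebraMap ℂ A) ⊗ₖ 1 := by
    ext ⟨i, j⟩ ⟨k, l⟩; simp [one_apply, apply_ite (algebraMap ℂ A)]
  have scalar_right (K : Matrix (Fin 2) (Fin 2) ℂ) :
      ((1 : Matrix (Fin 2) (Fin 2) ℂ) ⊗ₖ K).map (algebraMap ℂ A) =
        1 ⊗ₖ K.map (algebraMap ℂ A) := by
    ext ⟨i, j⟩ ⟨k, l⟩; simp [one_apply, apply_ite (algebraMap ℂ A)]
  have hK := congrArg (fun X => X.map (algebraMap ℂ A)) (Kbdry_reflection η ξm lam μ)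
  simp only [Matrix.map_mul, scalar_left, scalar_right] at hK
  obtain ⟨u, hu⟩ := hinv (-lam)
  obtain ⟨v, hv⟩ := hinv (-μ)
  let u₁ : (Matrix (Fin 2 × Fin 2) (Fin 2 × Fin 2) A)ˣ :=
    ⟨u.val ⊗ₖ 1, u⁻¹.val ⊗ₖ 1, by rw [← mul_kronecker_one]; simp,
      by rw [← mul_kronecker_one]; simp⟩
  let v₂ : (Matrix (Fin 2 × Fin 2) (Fin 2 × Fin 2) A)ˣ :=
    ⟨1 ⊗ₖ v.val, 1 ⊗ₖ v⁻¹.val, by rw [← one_kronecker_mul]; simp,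
      by rw [← one_kronecker_mul]; simp⟩
  have h₁ := hYBA lam (-μ)
  have h₂ := yangBaxter_swap (hYBA μ (-lam))
  have h₃ := yangBaxter_swap (hYBA (-μ) (-lam))
  rw [sub_neg_eq_add, ← hv] at h₁
  rw [sub_neg_eq_add, add_comm μ lam, ← hu] at h₂
  rw [neg_sub_neg, ← hu, ← hv] at h₃
  simp only [Tminus, ← hu, ← hv, Ring.inverse_unit, mul_kronecker_one, one_kronecker_mul]
  exact reflection_of_dressing (a' := u₁) (b' := v₂) hK (hYBA lam μ) h₁ h₂ h₃
    (commute_scalar_kronecker_one _ _) (commute_scalar_kronecker_one _ _)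
    (commute_kronecker_scalar _ _) (commute_kronecker_scalar _ _)
end

section
/- Fix ξ⁺, ξ⁻ ∈ ℂ with sinh ξ⁺ ≠ 0 and sinh ξ⁻ ≠ 0, and set K⁺(λ) = ½ · K(λ+η, ξ⁺) and K⁻(λ) = K(λ, ξ⁻). Define the open-chain transfer matrix t(λ) = tr₀[ K⁺(λ) · T(λ) · K⁻(λ) · T(−λ)⁻¹ ] ∈ End((ℂ²)^{⊗L}), where the product is taken as 2×2 matrices over End((ℂ²)^{⊗L}) and tr₀ is the trace over the 2×2 auxiliary matrix structure. Then for all λ, μ ∈ ℂ such that cosh λ, cosh μ, cosh(λ+η), cosh(μ+η) are nonzero and T(−λ) and T(−μ) are invertible, the transfer matrices commute: t(λ) · t(μ) = t(μ) · t(λ). -/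
open Complex Matrix

/-- `R_{0j}(λ)`: the six-vertex `R`-matrix acting on the auxiliary space `0` and
the `j`-th quantum space of `ℂ² ⊗ (ℂ²)^{⊗L}`, and as the identity elsewhere.
The quantum space `(ℂ²)^{⊗L}` is encoded by basis indices `Fin L → Fin 2`. -/
noncomputable def R0j (L : ℕ) (η lam : ℂ) (j : Fin L) :
    Matrix (Fin 2 × (Fin L → Fin 2)) (Fin 2 × (Fin L → Fin 2)) ℂ :=
  Matrix.of fun p q =>
    R6v η lam (p.1, p.2 j) (q.1, q.2 j) *
      (if ∀ k, k ≠ j → p.2 k = q.2 k then 1 else 0)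

/-- The inhomogeneous monodromy matrix `T(λ) = R_{0L}(λ−s_L)⋯R_{01}(λ−s_1)` as an
endomorphism of `ℂ² ⊗ (ℂ²)^{⊗L}`. -/
noncomputable def Tfull (L : ℕ) (η : ℂ) (s : Fin L → ℂ) (lam : ℂ) :
    Matrix (Fin 2 × (Fin L → Fin 2)) (Fin 2 × (Fin L → Fin 2)) ℂ :=
  (((List.finRange L).reverse).map (fun j => R0j L η (lam - s j) j)).prod

/-- The monodromy matrix viewed as a `2×2` matrix
`T(λ) = [[A(λ),B(λ)],[C(λ),D(λ)]]` over the auxiliary space, with entries in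
`End((ℂ²)^{⊗L})`. -/
noncomputable def Tmono (L : ℕ) (η : ℂ) (s : Fin L → ℂ) (lam : ℂ) :
    Matrix (Fin 2) (Fin 2) (Matrix (Fin L → Fin 2) (Fin L → Fin 2) ℂ) :=
  Matrix.of fun α β => Matrix.of fun v w => Tfull L η s lam (α, v) (β, w)

/-- `a(λ) = ∏_{l=1}^L sinh(λ−s_l+η)`. -/
noncomputable def afun (η : ℂ) {L : ℕ} (s : Fin L → ℂ) (lam : ℂ) : ℂ :=
  ∏ l, sinh (lam - s l + η)

/-- `d(λ) = ∏_{l=1}^L sinh(λ−s_l)`. -/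
noncomputable def dfun {L : ℕ} (s : Fin L → ℂ) (lam : ℂ) : ℂ :=
  ∏ l, sinh (lam - s l)

/-- The open-chain transfer matrix
`t(λ) = tr₀[K⁺(λ) · T(λ) · K⁻(λ) · T(−λ)⁻¹] ∈ End((ℂ²)^{⊗L})`, where the product is
taken as `2×2` matrices over `End((ℂ²)^{⊗L})` and `tr₀` is the trace over the
auxiliary `2×2` matrix structure. -/
noncomputable def transfer (L : ℕ) (η : ℂ) (s : Fin L → ℂ) (ξp ξm lam : ℂ) :
    Matrix (Fin L → Fin 2) (Fin L → Fin 2) ℂ :=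
  Matrix.trace
    ((Kplus η ξp lam).map (algebraMap ℂ (Matrix (Fin L → Fin 2) (Fin L → Fin 2) ℂ)) *
      Tmono L η s lam *
      (Kbdry ξm lam).map (algebraMap ℂ (Matrix (Fin L → Fin 2) (Fin L → Fin 2) ℂ)) *
      Ring.inverse (Tmono L η s (-lam)))

section Auxiliary

variable {n A : Type*} [Fintype n] [DecidableEq n] [Ring A]

/-- The endomorphism `M ⊗ 1` of a doubled auxiliary space. -/
def auxLeft (n A : Type*) [Fintype n] [DecidableEq n] [Ring A] :
    Matrix n n A →* Matrix (n × n) (n × n) A where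
  toFun M := Matrix.blockDiagonal fun _ => M
  map_one' := Matrix.blockDiagonal_one
  map_mul' M N := Matrix.blockDiagonal_mul (fun _ : n => M) (fun _ : n => N)

/-- Conjugation by the permutation of the two auxiliary spaces. -/
def auxSwap (n A : Type*) [Fintype n] [DecidableEq n] [Ring A] :
    Matrix (n × n) (n × n) A →* Matrix (n × n) (n × n) A where
  toFun M := M.submatrix Prod.swap Prod.swap
  map_one' := Matrix.submatrix_one_equiv (Equiv.prodComm n n)
  map_mul' M N := (Matrix.submatrix_mul_equiv M N Prod.swap (Equiv.prodComm n n) Prod.swap).symm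

/-- The endomorphism `1 ⊗ M` of a doubled auxiliary space. -/
def auxRight (n A : Type*) [Fintype n] [DecidableEq n] [Ring A] :
    Matrix n n A →* Matrix (n × n) (n × n) A :=
  (auxSwap n A).comp (auxLeft n A)

theorem auxLeft_apply (M : Matrix n n A) (p q : n × n) :
    auxLeft n A M p q = if p.2 = q.2 then M p.1 q.1 else 0 := rfl

theorem auxRight_apply (M : Matrix n n A) (p q : n × n) :
    auxRight n A M p q = if p.1 = q.1 then M p.2 q.2 else 0 := rfl

theorem auxSwap_apply (M : Matrix (n × n) (n × n) A) (p q : n × n) :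
    auxSwap n A M p q = M p.swap q.swap := rfl

theorem auxSwap_auxLeft (M : Matrix n n A) : auxSwap n A (auxLeft n A M) = auxRight n A M := rfl

theorem auxSwap_auxRight (M : Matrix n n A) : auxSwap n A (auxRight n A M) = auxLeft n A M := rfl

theorem auxLeft_mul_auxRight_apply (M N : Matrix n n A) (p q : n × n) :
    (auxLeft n A M * auxRight n A N) p q = M p.1 q.1 * N p.2 q.2 := by
  simp [Matrix.mul_apply, Fintype.sum_prod_type, auxLeft_apply, auxRight_apply]

theorem auxRight_mul_auxLeft_apply (M N : Matrix n n A) (p q : n × n) :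
    (auxRight n A N * auxLeft n A M) p q = N p.2 q.2 * M p.1 q.1 := by
  simp [Matrix.mul_apply, Fintype.sum_prod_type, auxLeft_apply, auxRight_apply]

theorem commute_auxLeft_auxRight {M N : Matrix n n A}
    (h : ∀ i j k l, Commute (M i j) (N k l)) :
    Commute (auxLeft n A M) (auxRight n A N) := by
  ext p q
  rw [auxLeft_mul_auxRight_apply, auxRight_mul_auxLeft_apply]
  exact h _ _ _ _

theorem commute_list_prod_apply {M : Matrix n n A}
    {l : List (Matrix n n A)} (h : ∀ N ∈ l, ∀ i j k m, Commute (M i j) (N k m)) (i j k m : n) :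
    Commute (M i j) (l.prod k m) := by
  induction l generalizing k m with
  | nil =>
    rw [List.prod_nil, Matrix.one_apply]
    split_ifs
    · exact Commute.one_right _
    · exact Commute.zero_right _
  | cons N l ih =>
    rw [List.prod_cons, Matrix.mul_apply]
    exact Commute.sum_right _ _ _ fun x _ => (h N List.mem_cons_self i j k x).mul_right
      (ih (fun N' hN' => h N' (List.mem_cons_of_mem _ hN')) x m)

end Auxiliary

/-- The six-vertex `R`-matrix with entries in a complex algebra. -/
noncomputable def sixVertex (A : Type*) [Ring A] [Algebra ℂ A] (η u : ℂ) :
    Matrix (Fin 2 × Fin 2) (Fin 2 × Fin 2) A :=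
  (R6v η u).map (algebraMap ℂ A)

theorem auxSwap_sixVertex (A : Type*) [Ring A] [Algebra ℂ A] (η u : ℂ) :
    auxSwap (Fin 2) A (sixVertex A η u) = sixVertex A η u := by
  ext ⟨a, b⟩ ⟨c, d⟩
  fin_cases a <;> fin_cases b <;> fin_cases c <;> fin_cases d <;>
    simp [auxSwap_apply, sixVertex, R6v]

/-- The boundary Yang-Baxter algebra: conjugating a solution of the reflection equation
by commuting dressings again gives a solution. -/
theorem reflection_dressing {G : Type*} [Monoid G]
    {Rm Rp T₁ K₁ X₁ T₂ K₂ X₂ : G}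
    (hT : Rm * T₁ * T₂ = T₂ * T₁ * Rm)
    (hX : Rm * X₁ * X₂ = X₂ * X₁ * Rm)
    (hXT : X₁ * Rp * T₂ = T₂ * Rp * X₁)
    (hTX : T₁ * Rp * X₂ = X₂ * Rp * T₁)
    (hK : Rm * K₁ * Rp * K₂ = K₂ * Rp * K₁ * Rm)
    (hKT : Commute K₁ T₂) (hKX : Commute K₁ X₂)
    (hTK : Commute T₁ K₂) (hXK : Commute X₁ K₂) :
    Rm * (T₁ * K₁ * X₁) * Rp * (T₂ * K₂ * X₂) =
      (T₂ * K₂ * X₂) * Rp * (T₁ * K₁ * X₁) * Rm := by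
  calc Rm * (T₁ * K₁ * X₁) * Rp * (T₂ * K₂ * X₂)
      = Rm * T₁ * K₁ * (X₁ * Rp * T₂) * K₂ * X₂ := by simp only [mul_assoc]
    _ = Rm * T₁ * (K₁ * T₂) * Rp * (X₁ * K₂) * X₂ := by rw [hXT]; simp only [mul_assoc]
    _ = (Rm * T₁ * T₂) * K₁ * Rp * K₂ * X₁ * X₂ := by
        rw [hKT.eq, hXK.eq]; simp only [mul_assoc]
    _ = T₂ * T₁ * (Rm * K₁ * Rp * K₂) * X₁ * X₂ := by rw [hT]; simp only [mul_assoc]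
    _ = T₂ * T₁ * K₂ * Rp * K₁ * (Rm * X₁ * X₂) := by rw [hK]; simp only [mul_assoc]
    _ = T₂ * (T₁ * K₂) * Rp * (K₁ * X₂) * X₁ * Rm := by rw [hX]; simp only [mul_assoc]
    _ = T₂ * K₂ * (T₁ * Rp * X₂) * K₁ * X₁ * Rm := by
        rw [hTK.eq, hKX.eq]; simp only [mul_assoc]
    _ = (T₂ * K₂ * X₂) * Rp * (T₁ * K₁ * X₁) * Rm := by rw [hTX]; simp only [mul_assoc]

theorem Kbdry_off_diagonal (ξ u : ℂ) : Kbdry ξ u 0 1 = 0 ∧ Kbdry ξ u 1 0 = 0 := by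
  simp [Kbdry]

theorem Kbdry_exchange (ξ u v : ℂ) :
    sinh (u - v) * (Kbdry ξ u 0 0 * Kbdry ξ v 0 0 - Kbdry ξ u 1 1 * Kbdry ξ v 1 1) =
      sinh (u + v) * (Kbdry ξ u 0 0 * Kbdry ξ v 1 1 - Kbdry ξ u 1 1 * Kbdry ξ v 0 0) := by
  have h : sinh (u - v) * (sinh (u + ξ) * sinh (v + ξ) - sinh (u - ξ) * sinh (v - ξ)) =
      sinh (u + v) * (sinh (u - ξ) * sinh (v + ξ) - sinh (u + ξ) * sinh (v - ξ)) := by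
    simp only [sinh_add, sinh_sub]
    ring
  simp only [Kbdry, Matrix.smul_apply, Matrix.diagonal_apply_eq, smul_eq_mul, if_true,
    one_ne_zero, if_false]
  linear_combination (1 / (sinh ξ * cosh u)) * (1 / (sinh ξ * cosh v)) * h

theorem sixVertex_boundary_reflection (A : Type*) [Ring A] [Algebra ℂ A] (η ξ u v : ℂ) :
    sixVertex A η (u - v) * auxLeft (Fin 2) A ((Kbdry ξ u).map (algebraMap ℂ A)) *
        sixVertex A η (u + v) * auxRight (Fin 2) A ((Kbdry ξ v).map (algebraMap ℂ A)) =
      auxRight (Fin 2) A ((Kbdry ξ v).map (algebraMap ℂ A)) * sixVertex A η (u + v) *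
        auxLeft (Fin 2) A ((Kbdry ξ u).map (algebraMap ℂ A)) * sixVertex A η (u - v) := by
  have hl (M : Matrix (Fin 2) (Fin 2) ℂ) : auxLeft (Fin 2) A (M.map (algebraMap ℂ A)) =
      (auxLeft (Fin 2) ℂ M).map (algebraMap ℂ A) := by
    ext p q; simp only [auxLeft_apply, Matrix.map_apply]; split_ifs <;> simp
  have hr (M : Matrix (Fin 2) (Fin 2) ℂ) : auxRight (Fin 2) A (M.map (algebraMap ℂ A)) =
      (auxRight (Fin 2) ℂ M).map (algebraMap ℂ A) := by
    ext p q; simp only [auxRight_apply, Matrix.map_apply]; split_ifs <;> simp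
  simp only [sixVertex, hl, hr, ← Matrix.map_mul]
  congr 1
  have key := Kbdry_exchange ξ u v
  ext ⟨a, b⟩ ⟨c, d⟩
  fin_cases a <;> fin_cases b <;> fin_cases c <;> fin_cases d <;>
    simp only [Matrix.mul_apply, Fintype.sum_prod_type, Fin.sum_univ_two, auxLeft_apply,
      auxRight_apply, R6v, Matrix.of_apply, Kbdry_off_diagonal] <;>
    simp [Kbdry_off_diagonal] <;>
    first
    | linear_combination sinh η * key
    | linear_combination (-sinh η) * key
    | ring1

section Sites

variable {ι m : Type*} [Fintype ι] [DecidableEq ι] [Fintype m] [DecidableEq m]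

/-- The operator acting by `M` on the tensor factor `j` and as the identity elsewhere. -/
def siteMatrix (j : ι) (M : Matrix m m ℂ) : Matrix (ι → m) (ι → m) ℂ :=
  Matrix.of fun v w => M (v j) (w j) * if ∀ k, k ≠ j → v k = w k then 1 else 0

theorem sum_eq_update_off (j : ι) (v : ι → m) (f : (ι → m) → ℂ) :
    ∑ x, (if ∀ k, k ≠ j → v k = x k then f x else 0) = ∑ t, f (Function.update v j t) := by
  rw [← Finset.sum_filter]
  symm
  refine Finset.sum_bij (fun t _ => Function.update v j t) ?_ ?_ ?_ ?_
  · intro t _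
    simp only [Finset.mem_filter, Finset.mem_univ, true_and]
    intro k hk
    rw [Function.update_of_ne hk]
  · intro t _ t' _ h
    exact Function.update_injective v j h
  · intro x hx
    refine ⟨x j, Finset.mem_univ _, ?_⟩
    funext k
    by_cases hk : k = j
    · subst hk; simp
    · rw [Function.update_of_ne hk]
      exact (Finset.mem_filter.1 hx).2 k hk
  · intro _ _; rfl

theorem siteMatrix_mul_apply (j : ι) (M : Matrix m m ℂ) (N : Matrix (ι → m) (ι → m) ℂ)
    (v w : ι → m) :
    (siteMatrix j M * N) v w = ∑ t, M (v j) t * N (Function.update v j t) w := by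
  have h := sum_eq_update_off j v fun x => M (v j) (x j) * N x w
  simp only [Function.update_self] at h
  rw [← h, Matrix.mul_apply]
  refine Finset.sum_congr rfl fun x _ => ?_
  simp only [siteMatrix, Matrix.of_apply]
  split_ifs <;> simp

theorem siteMatrix_mul (j : ι) (M N : Matrix m m ℂ) :
    siteMatrix j (M * N) = siteMatrix j M * siteMatrix j N := by
  ext v w
  rw [siteMatrix_mul_apply]
  simp only [siteMatrix, Matrix.of_apply, Matrix.mul_apply, Function.update_self, Finset.sum_mul]
  refine Finset.sum_congr rfl fun t _ => ?_
  have : (∀ k, k ≠ j → v k = w k) ↔ ∀ k, k ≠ j → Function.update v j t k = w k :=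
    forall₂_congr fun k hk => by rw [Function.update_of_ne hk]
  rw [if_congr this rfl rfl, mul_assoc]

theorem siteMatrix_commute {j k : ι} (hjk : j ≠ k) (M N : Matrix m m ℂ) :
    Commute (siteMatrix j M) (siteMatrix k N) := by
  have key : ∀ {j k : ι}, j ≠ k → ∀ (M N : Matrix m m ℂ) (v w : ι → m),
      (siteMatrix j M * siteMatrix k N) v w = M (v j) (w j) * N (v k) (w k) *
        if ∀ l, l ≠ j → l ≠ k → v l = w l then 1 else 0 := by
    intro j k hjk M N v w
    rw [siteMatrix_mul_apply, Finset.sum_eq_single (w j)]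
    · simp only [siteMatrix, Matrix.of_apply, Function.update_of_ne hjk.symm]
      rw [mul_assoc]
      congr 3
      apply propext
      constructor
      · intro h l hj hk
        simpa [hj] using h l hk
      · intro h l hk
        by_cases hj : l = j
        · subst hj; simp
        · simpa [hj] using h l hj hk
    · intro t _ ht
      have : ¬ ∀ l, l ≠ k → Function.update v j t l = w l := fun h => ht (by simpa using h j hjk)
      simp [siteMatrix, this]
    · simp
  ext v w
  rw [key hjk, key hjk.symm, mul_comm (M _ _)]
  congr 2
  apply propext
  exact forall_congr' fun l => forall_comm

end Sites

section Naturality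

variable {A B : Type*} [Ring A] [Ring B] [Algebra ℂ A] [Algebra ℂ B]

theorem auxLeft_map {n : Type*} [Fintype n] [DecidableEq n] (f : A →ₐ[ℂ] B) (M : Matrix n n A) :
    auxLeft n B (M.map f) = (auxLeft n A M).map f := by
  ext p q
  simp only [auxLeft_apply, Matrix.map_apply]
  split_ifs <;> simp

theorem auxRight_map {n : Type*} [Fintype n] [DecidableEq n] (f : A →ₐ[ℂ] B) (M : Matrix n n A) :
    auxRight n B (M.map f) = (auxRight n A M).map f := by
  ext p q
  simp only [auxRight_apply, Matrix.map_apply]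
  split_ifs <;> simp

theorem sixVertex_map (f : A →ₐ[ℂ] B) (η u : ℂ) :
    sixVertex B η u = (sixVertex A η u).map f := by
  ext p q
  simp [sixVertex]

end Naturality

/-- The six-vertex Lax operator: the `R`-matrix as a matrix over the first tensor factor. -/
noncomputable def sixVertexLax (η u : ℂ) : Matrix (Fin 2) (Fin 2) (Matrix (Fin 2) (Fin 2) ℂ) :=
  Matrix.of fun α β => Matrix.of fun i k => R6v η u (α, i) (β, k)

theorem sinh_mul_sinh_add (a b c : ℂ) :
    sinh a * sinh (b + c) = sinh b * sinh (a + c) + sinh (a - b) * sinh c := by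
  simp only [sinh_add, sinh_sub]
  ring

set_option maxHeartbeats 1000000 in
/-- The Yang-Baxter equation for the six-vertex `R`-matrix, in components. -/
theorem R6v_yangBaxter (η u v : ℂ) (p₁ p₂ q₁ q₂ i k : Fin 2) :
    ∑ x, ∑ y, R6v η (u - v) (p₁, p₂) (x, y) *
        ∑ t, R6v η u (x, i) (q₁, t) * R6v η v (y, t) (q₂, k) =
      ∑ x, ∑ y, R6v η (u - v) (x, y) (q₁, q₂) *
        ∑ t, R6v η v (p₂, i) (y, t) * R6v η u (p₁, t) (x, k) := by
  have h₁ := sinh_mul_sinh_add u (u - v) η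
  have h₂ := sinh_mul_sinh_add (v + η) η (u - v)
  have h₃ := sinh_mul_sinh_add u v η
  rw [sub_sub_cancel] at h₁
  rw [add_sub_cancel_right, add_comm η, add_right_comm, add_sub_cancel] at h₂
  simp only [R6v, Matrix.of_apply, Fin.sum_univ_two]
  fin_cases p₁ <;> fin_cases p₂ <;> fin_cases q₁ <;> fin_cases q₂ <;> fin_cases i <;>
    fin_cases k <;> simp [-mul_eq_mul_left_iff] <;>
    first
    | ring1
    | linear_combination sinh η * h₁
    | linear_combination (-sinh η) * h₁
    | linear_combination sinh η * h₂
    | linear_combination (-sinh η) * h₂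
    | linear_combination sinh η * h₃
    | linear_combination (-sinh η) * h₃

theorem sixVertexLax_yangBaxter (η u v : ℂ) :
    sixVertex (Matrix (Fin 2) (Fin 2) ℂ) η (u - v) * auxLeft (Fin 2) _ (sixVertexLax η u) *
        auxRight (Fin 2) _ (sixVertexLax η v) =
      auxRight (Fin 2) _ (sixVertexLax η v) * auxLeft (Fin 2) _ (sixVertexLax η u) *
        sixVertex (Matrix (Fin 2) (Fin 2) ℂ) η (u - v) := by
  rw [mul_assoc]
  ext p q i k
  rw [Matrix.mul_apply, Matrix.mul_apply (N := sixVertex _ _ _)]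
  simp only [auxLeft_mul_auxRight_apply, auxRight_mul_auxLeft_apply, Fintype.sum_prod_type,
    sixVertex, Matrix.map_apply, ← Algebra.commutes, ← Algebra.smul_def, Matrix.sum_apply,
    Matrix.smul_apply, smul_eq_mul]
  simpa only [Matrix.mul_apply, sixVertexLax, Matrix.of_apply] using
    R6v_yangBaxter η u v p.1 p.2 q.1 q.2 i k

section YangBaxterAlgebra

variable {A : Type*} [Ring A] [Algebra ℂ A]

/-- The operator-valued matrix `T` satisfies the exchange relations of the six-vertex
Yang-Baxter algebra. -/
def IsYangBaxter (η : ℂ) (T : ℂ → Matrix (Fin 2) (Fin 2) A) : Prop :=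
  ∀ u v, sixVertex A η (u - v) * auxLeft (Fin 2) A (T u) * auxRight (Fin 2) A (T v) =
    auxRight (Fin 2) A (T v) * auxLeft (Fin 2) A (T u) * sixVertex A η (u - v)

theorem IsYangBaxter.one (η : ℂ) : IsYangBaxter η fun _ => (1 : Matrix (Fin 2) (Fin 2) A) := by
  intro u v
  simp

theorem IsYangBaxter.comp_sub {η : ℂ} {T : ℂ → Matrix (Fin 2) (Fin 2) A}
    (hT : IsYangBaxter η T) (s : ℂ) : IsYangBaxter η fun u => T (u - s) := by
  intro u v
  simpa only [sub_sub_sub_cancel_right] using hT (u - s) (v - s)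

theorem IsYangBaxter.map {B : Type*} [Ring B] [Algebra ℂ B] {η : ℂ}
    {T : ℂ → Matrix (Fin 2) (Fin 2) A} (hT : IsYangBaxter η T) (f : A →ₐ[ℂ] B) :
    IsYangBaxter η fun u => (T u).map f := by
  intro u v
  simp only [auxLeft_map, auxRight_map, sixVertex_map f, ← Matrix.map_mul]
  rw [hT u v]

theorem IsYangBaxter.mul {η : ℂ} {S T : ℂ → Matrix (Fin 2) (Fin 2) A}
    (hS : IsYangBaxter η S) (hT : IsYangBaxter η T)
    (h : ∀ u v i j k l, Commute (S u i j) (T v k l)) :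
    IsYangBaxter η fun u => S u * T u := by
  intro u v
  have hST := commute_auxLeft_auxRight (h u v)
  have hTS := commute_auxLeft_auxRight fun i j k l => (h v u k l i j).symm
  have hS := hS u v
  have hT := hT u v
  simp only [map_mul]
  generalize auxLeft (Fin 2) A (T u) = T₁ at *
  generalize auxRight (Fin 2) A (T v) = T₂ at *
  generalize auxLeft (Fin 2) A (S u) = S₁ at *
  generalize auxRight (Fin 2) A (S v) = S₂ at *
  generalize sixVertex A η (u - v) = R at *
  calc R * (S₁ * T₁) * (S₂ * T₂)
      = R * S₁ * (T₁ * S₂) * T₂ := by simp only [mul_assoc]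
    _ = (R * S₁ * S₂) * T₁ * T₂ := by rw [hTS.eq]; simp only [mul_assoc]
    _ = S₂ * S₁ * (R * T₁ * T₂) := by rw [hS]; simp only [mul_assoc]
    _ = S₂ * (S₁ * T₂) * T₁ * R := by rw [hT]; simp only [mul_assoc]
    _ = S₂ * T₂ * (S₁ * T₁) * R := by rw [hST.eq]; simp only [mul_assoc]

theorem IsYangBaxter.list_prod {ι : Type*} {η : ℂ} {S : ι → ℂ → Matrix (Fin 2) (Fin 2) A}
    (hS : ∀ a, IsYangBaxter η (S a))
    (h : ∀ a b, a ≠ b → ∀ u v i j k l, Commute (S a u i j) (S b v k l))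
    {l : List ι} (hl : l.Nodup) :
    IsYangBaxter η fun u => (l.map fun a => S a u).prod := by
  induction l with
  | nil => simpa only [List.map_nil, List.prod_nil] using IsYangBaxter.one η
  | cons a l ih =>
    obtain ⟨ha, hl⟩ := List.nodup_cons.1 hl
    simp only [List.map_cons, List.prod_cons]
    refine (hS a).mul (ih hl) fun u v => commute_list_prod_apply fun N hN => ?_
    obtain ⟨b, hb, rfl⟩ := List.mem_map.1 hN
    exact h a b (fun hab => ha (hab ▸ hb)) u v

theorem IsYangBaxter.swap {η : ℂ} {T : ℂ → Matrix (Fin 2) (Fin 2) A} (hT : IsYangBaxter η T)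
    (u v : ℂ) :
    sixVertex A η (v - u) * auxRight (Fin 2) A (T v) * auxLeft (Fin 2) A (T u) =
      auxLeft (Fin 2) A (T u) * auxRight (Fin 2) A (T v) * sixVertex A η (v - u) := by
  simpa only [map_mul, auxSwap_auxLeft, auxSwap_auxRight, auxSwap_sixVertex] using
    congrArg (auxSwap (Fin 2) A) (hT v u)

/-- The double-row monodromy matrix satisfies the reflection equation. -/
theorem IsYangBaxter.reflection {η : ℂ} {T : ℂ → Matrix (Fin 2) (Fin 2) A}
    (hT : IsYangBaxter η T) (ξ u v : ℂ) {X Y : Matrix (Fin 2) (Fin 2) A}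
    (hXl : X * T (-u) = 1) (hXr : T (-u) * X = 1) (hYl : Y * T (-v) = 1) (hYr : T (-v) * Y = 1) :
    sixVertex A η (u - v) *
        auxLeft (Fin 2) A (T u * (Kbdry ξ u).map (algebraMap ℂ A) * X) * sixVertex A η (u + v) *
        auxRight (Fin 2) A (T v * (Kbdry ξ v).map (algebraMap ℂ A) * Y) =
      auxRight (Fin 2) A (T v * (Kbdry ξ v).map (algebraMap ℂ A) * Y) * sixVertex A η (u + v) *
        auxLeft (Fin 2) A (T u * (Kbdry ξ u).map (algebraMap ℂ A) * X) *
        sixVertex A η (u - v) := by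
  have hKl (w : ℂ) (M : Matrix (Fin 2) (Fin 2) A) :
      Commute (auxLeft (Fin 2) A ((Kbdry ξ w).map (algebraMap ℂ A))) (auxRight (Fin 2) A M) :=
    commute_auxLeft_auxRight fun _ _ _ _ => Algebra.commutes _ _
  have hKr (w : ℂ) (M : Matrix (Fin 2) (Fin 2) A) :
      Commute (auxLeft (Fin 2) A M) (auxRight (Fin 2) A ((Kbdry ξ w).map (algebraMap ℂ A))) :=
    commute_auxLeft_auxRight fun _ _ _ _ => (Algebra.commutes _ _).symm
  have hXl := congrArg (auxLeft (Fin 2) A) hXl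
  have hXr := congrArg (auxLeft (Fin 2) A) hXr
  have hYl := congrArg (auxRight (Fin 2) A) hYl
  have hYr := congrArg (auxRight (Fin 2) A) hYr
  have hXY := hT.swap (-u) (-v)
  have hXT := hT.swap (-u) v
  have hTY := hT u (-v)
  rw [neg_sub_neg] at hXY
  rw [sub_neg_eq_add, add_comm v u] at hXT
  rw [sub_neg_eq_add] at hTY
  simp only [map_mul, map_one] at hXl hXr hYl hYr ⊢
  refine reflection_dressing (hT u v) ?_ ?_ ?_
    (sixVertex_boundary_reflection A η ξ u v) (hKl u _) (hKl u _) (hKr v _) (hKr v _)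
  all_goals
    generalize auxLeft (Fin 2) A X = X₁ at *
    generalize auxRight (Fin 2) A Y = X₂ at *
    generalize auxLeft (Fin 2) A (T (-u)) = S₁ at *
    generalize auxRight (Fin 2) A (T (-v)) = S₂ at *
  · generalize sixVertex A η (u - v) = R at *
    calc R * X₁ * X₂ = X₂ * ((X₁ * S₁) * S₂) * R * X₁ * X₂ := by
          rw [hXl, one_mul, hYl, one_mul]
      _ = X₂ * X₁ * (S₁ * S₂ * R) * X₁ * X₂ := by simp only [mul_assoc]
      _ = X₂ * X₁ * R * (S₂ * (S₁ * X₁) * X₂) := by rw [← hXY]; simp only [mul_assoc]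
      _ = X₂ * X₁ * R := by rw [hXr, mul_one, hYr, mul_one]
  · generalize sixVertex A η (u + v) = R at *
    generalize auxRight (Fin 2) A (T v) = T₂ at *
    calc X₁ * R * T₂ = X₁ * (R * T₂ * S₁) * X₁ := by simp only [mul_assoc, hXr, mul_one]
      _ = (X₁ * S₁) * T₂ * R * X₁ := by rw [hXT]; simp only [mul_assoc]
      _ = T₂ * R * X₁ := by rw [hXl, one_mul]
  · generalize sixVertex A η (u + v) = R at *
    generalize auxLeft (Fin 2) A (T u) = T₁ at *
    calc T₁ * R * X₂ = (X₂ * S₂) * T₁ * R * X₂ := by rw [hYl, one_mul]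
      _ = X₂ * (S₂ * T₁ * R) * X₂ := by simp only [mul_assoc]
      _ = X₂ * R * T₁ := by rw [← hTY]; simp only [mul_assoc, hYr, mul_one]

end YangBaxterAlgebra

section Monodromy

variable {ι : Type*} [Fintype ι] [DecidableEq ι]

/-- The embedding of the operators on the tensor factor `j` into the operators on all factors. -/
noncomputable def siteHom {m : Type*} [Fintype m] [DecidableEq m] (j : ι) :
    Matrix m m ℂ →ₐ[ℂ] Matrix (ι → m) (ι → m) ℂ :=
  AlgHom.ofLinearMap
    { toFun := siteMatrix j
      map_add' := fun M N => by
        ext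
        simp only [siteMatrix, Matrix.of_apply, Matrix.add_apply, add_mul]
      map_smul' := fun c M => by ext; simp [siteMatrix] }
    (by
      ext v w
      simp only [siteMatrix, LinearMap.coe_mk, AddHom.coe_mk, Matrix.of_apply, Matrix.one_apply,
        ← ite_and, mul_ite, mul_one, mul_zero]
      refine if_congr ⟨fun h => ?_, ?_⟩ rfl rfl
      · funext k
        by_cases hk : k = j
        · exact hk ▸ h.2
        · exact h.1 k hk
      · rintro rfl
        simp)
    (siteMatrix_mul j)

/-- The Lax operator acting on the auxiliary space and the tensor factor `j`. -/
noncomputable def siteLax (η : ℂ) (j : ι) (u : ℂ) :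
    Matrix (Fin 2) (Fin 2) (Matrix (ι → Fin 2) (ι → Fin 2) ℂ) :=
  (sixVertexLax η u).map (siteHom j)

theorem siteLax_yangBaxter (η : ℂ) (j : ι) : IsYangBaxter η (siteLax η j) :=
  IsYangBaxter.map (sixVertexLax_yangBaxter η) (siteHom j)

end Monodromy

theorem Tmono_eq_list_prod (L : ℕ) (η : ℂ) (s : Fin L → ℂ) (u : ℂ) :
    Tmono L η s u =
      ((List.finRange L).reverse.map fun j => siteLax η j (u - s j)).prod := by
  have h : Tmono L η s u = (Matrix.compRingEquiv _ _ _).symm (Tfull L η s u) := rfl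
  rw [h, Tfull, map_list_prod, List.map_map]
  refine congrArg List.prod (List.map_congr_left fun j _ => ?_)
  ext α β v w
  refine congrArg (R6v η (u - s j) (α, v j) (β, w j) * ·) ?_
  congr

theorem Tmono_yangBaxter (L : ℕ) (η : ℂ) (s : Fin L → ℂ) : IsYangBaxter η (Tmono L η s) := by
  have h : Tmono L η s = fun u =>
      ((List.finRange L).reverse.map fun j => siteLax η j (u - s j)).prod :=
    funext (Tmono_eq_list_prod L η s)
  rw [h]
  exact IsYangBaxter.list_prod (fun j => (siteLax_yangBaxter η j).comp_sub (s j))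
    (fun _ _ hjk _ _ _ _ _ _ => siteMatrix_commute hjk _ _)
    (List.nodup_reverse.2 (List.nodup_finRange L))

theorem sinh_sq_sub_sinh_sq (x y : ℂ) :
    sinh x ^ 2 - sinh y ^ 2 = sinh (x + y) * sinh (x - y) := by
  rw [sinh_add, sinh_sub]
  linear_combination sinh y ^ 2 * cosh_sq x - sinh x ^ 2 * cosh_sq y

section Trace

variable {A : Type*} [Ring A] [Algebra ℂ A]

set_option maxHeartbeats 4000000 in
/-- The boundary-weighted traces of a solution of the reflection equation commute, up to a
scalar which vanishes only on degenerate spectral parameters. -/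
theorem reflection_trace_commute (η ξ u v : ℂ) {U V : Matrix (Fin 2) (Fin 2) A}
    (h : sixVertex A η (u - v) * auxLeft (Fin 2) A U * sixVertex A η (u + v) *
        auxRight (Fin 2) A V =
      auxRight (Fin 2) A V * sixVertex A η (u + v) * auxLeft (Fin 2) A U *
        sixVertex A η (u - v)) :
    (sinh (u + v) * sinh (u + v + 2 * η) * sinh (u - v + η) * sinh (u - v - η)) •
        ((sinh (u + η + ξ) • U 0 0 + -sinh (u + η - ξ) • U 1 1) *
          (sinh (v + η + ξ) • V 0 0 + -sinh (v + η - ξ) • V 1 1)) =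
      (sinh (u + v) * sinh (u + v + 2 * η) * sinh (u - v + η) * sinh (u - v - η)) •
        ((sinh (v + η + ξ) • V 0 0 + -sinh (v + η - ξ) • V 1 1) *
          (sinh (u + η + ξ) • U 0 0 + -sinh (u + η - ξ) • U 1 1)) := by
  have e (p q : Fin 2 × Fin 2) := congrFun (congrFun h p) q
  simp only [Matrix.mul_apply, Fintype.sum_prod_type, Fin.sum_univ_two, auxLeft_apply,
    auxRight_apply, sixVertex, Matrix.map_apply, Algebra.algebraMap_eq_smul_one] at e
  have e₁ := e (0, 0) (0, 0)
  have e₂ := e (0, 1) (0, 1)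
  have e₃ := e (1, 0) (0, 1)
  have e₄ := e (0, 1) (1, 0)
  have e₅ := e (1, 0) (1, 0)
  have e₆ := e (1, 1) (1, 1)
  simp [R6v] at e₁ e₂ e₃ e₄ e₅ e₆
  clear e h
  simp only [add_mul, mul_add, smul_mul_assoc, mul_smul_comm] at e₁ e₂ e₃ e₄ e₅ e₆ ⊢
  have hC := sinh_sq_sub_sinh_sq (u - v) η
  have hD : sinh (u + v + η) ^ 2 - sinh η ^ 2 = sinh (u + v) * sinh (u + v + 2 * η) := by
    rw [sinh_sq_sub_sinh_sq, add_sub_cancel_right, mul_comm, two_mul, ← add_assoc]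
  have hk : sinh (u - v) * (sinh (u + η + ξ) * sinh (v + η + ξ) -
        -sinh (u + η - ξ) * -sinh (v + η - ξ)) =
      sinh (u + v + 2 * η) * (sinh (u + η + ξ) * -sinh (v + η - ξ) -
        -sinh (u + η - ξ) * sinh (v + η + ξ)) := by
    rw [show u - v = (u + η) - (v + η) by ring, show u + v + 2 * η = (u + η) + (v + η) by ring]
    generalize u + η = x
    generalize v + η = y
    simp only [sinh_add, sinh_sub]
    ring
  generalize sinh (u + η + ξ) = k₁ at *
  generalize -sinh (u + η - ξ) = k₂ at *
  generalize sinh (v + η + ξ) = l₁ at *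
  generalize -sinh (v + η - ξ) = l₂ at *
  generalize sinh (u + v + η) = a at *
  generalize sinh (u - v + η) = d at *
  generalize sinh (u + v) = e at *
  generalize sinh (u - v) = b at *
  generalize sinh η = c at *
  generalize sinh (u - v - η) = f at *
  generalize sinh (u + v + 2 * η) = g at *
  linear_combination (norm := skip) (a * k₁ * l₁ * f) • e₁ +
    (g * k₁ * l₂ * b + c ^ 2 * k₂ * l₂) • e₂ +
    (-c * g * k₁ * l₂ - c * k₂ * l₂ * b) • e₃ + (-c * k₁ * l₁ * b - c * g * k₂ * l₁) • e₄ +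
    (c ^ 2 * k₁ * l₁ + g * k₂ * l₁ * b) • e₅ + (a * k₂ * l₂ * f) • e₆
  match_scalars
  all_goals clear e₁ e₂ e₃ e₄ e₅ e₆
  all_goals first | ring1 | grind

end Trace

theorem MulEquiv.map_ringInverse {M N : Type*} [MonoidWithZero M] [MonoidWithZero N] (e : M ≃* N)
    (a : M) : e (Ring.inverse a) = Ring.inverse (e a) := by
  by_cases h : IsUnit a
  · obtain ⟨u, rfl⟩ := h
    rw [Ring.inverse_unit, ← MulEquiv.coe_toMonoidHom e, ← Units.coe_map, map_inv,
      ← Units.coe_map, Ring.inverse_unit]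
  · rw [Ring.inverse_non_unit _ h, Ring.inverse_non_unit _ (mt (MulEquiv.isUnit_map e).1 h),
      map_zero]

theorem ContinuousAt.matrix_inv {X n 𝕜 : Type*} [TopologicalSpace X] [Fintype n] [DecidableEq n]
    [NormedField 𝕜] {M : X → Matrix n n 𝕜} {x : X} (hM : Continuous M)
    (hx : (M x).det ≠ 0) : ContinuousAt (fun y => (M y)⁻¹) x := by
  simp only [Matrix.inv_def, Ring.inverse_eq_inv']
  exact (hM.matrix_det.continuousAt.inv₀ hx).smul hM.matrix_adjugate.continuousAt

theorem continuous_R6v (η : ℂ) : Continuous (R6v η) := by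
  refine continuous_matrix fun p q => ?_
  simp only [R6v, Matrix.of_apply]
  split_ifs <;> fun_prop

theorem continuousAt_Kbdry {ξ z : ℂ} (hξ : sinh ξ ≠ 0) (hz : cosh z ≠ 0) :
    ContinuousAt (Kbdry ξ) z := by
  have hd : Continuous fun z : ℂ =>
      (Matrix.diagonal fun i : Fin 2 => if i = 0 then sinh (z + ξ) else -sinh (z - ξ)) := by
    refine Continuous.matrix_diagonal (continuous_pi fun i => ?_)
    split_ifs <;> fun_prop
  have hs : ContinuousAt (fun z => 1 / (sinh ξ * cosh z)) z :=
    continuousAt_const.div (continuousAt_const.mul continuous_cosh.continuousAt)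
      (mul_ne_zero hξ hz)
  exact hs.smul hd.continuousAt

section Transfer

variable (L : ℕ) (η : ℂ) (s : Fin L → ℂ)

theorem Tmono_eq_compRingEquiv_symm (z : ℂ) :
    Tmono L η s z =
      (Matrix.compRingEquiv (Fin 2) (Fin L → Fin 2) ℂ).symm (Tfull L η s z) :=
  rfl

theorem isUnit_Tmono_iff (z : ℂ) : IsUnit (Tmono L η s z) ↔ (Tfull L η s z).det ≠ 0 := by
  rw [Tmono_eq_compRingEquiv_symm, MulEquiv.isUnit_map, Matrix.isUnit_iff_isUnit_det,
    isUnit_iff_ne_zero]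

theorem ringInverse_Tmono (z : ℂ) :
    Ring.inverse (Tmono L η s z) =
      (Matrix.compRingEquiv (Fin 2) (Fin L → Fin 2) ℂ).symm (Tfull L η s z)⁻¹ := by
  rw [Matrix.nonsing_inv_eq_ringInverse, Tmono_eq_compRingEquiv_symm]
  exact (MulEquiv.map_ringInverse (M := Matrix (Fin 2 × (Fin L → Fin 2)) _ ℂ)
    (N := Matrix (Fin 2) _ (Matrix (Fin L → Fin 2) _ ℂ))
    (Matrix.compRingEquiv (Fin 2) (Fin L → Fin 2) ℂ).symm.toMulEquiv _).symm

theorem continuous_Tfull : Continuous (Tfull L η s) := by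
  refine continuous_list_prod _ fun j _ => ?_
  refine continuous_matrix fun p q => ?_
  exact (((continuous_R6v η).comp (continuous_id.sub continuous_const)).matrix_elem _ _).mul
    continuous_const

theorem continuous_Tmono : Continuous (Tmono L η s) := by
  refine continuous_matrix fun α β => continuous_matrix fun v w => ?_
  exact (continuous_Tfull L η s).matrix_elem (α, v) (β, w)

theorem continuousAt_ringInverse_Tmono {z : ℂ} (h : IsUnit (Tmono L η s z)) :
    ContinuousAt (fun x => Ring.inverse (Tmono L η s x)) z := by
  simp only [ringInverse_Tmono]
  have hinv := ContinuousAt.matrix_inv (continuous_Tfull L η s) ((isUnit_Tmono_iff L η s z).1 h)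
  have hcomp : Continuous (Matrix.compRingEquiv (Fin 2) (Fin L → Fin 2) ℂ).symm :=
    continuous_matrix fun α β => continuous_matrix fun v w =>
      continuous_id.matrix_elem (α, v) (β, w)
  exact hcomp.continuousAt.comp hinv

theorem transfer_eq_smul (ξp ξm z : ℂ) :
    transfer L η s ξp ξm z =
      ((2 : ℂ)⁻¹ * (1 / (sinh ξp * cosh (z + η)))) •
        (sinh (z + η + ξp) • (Tmono L η s z * (Kbdry ξm z).map (algebraMap ℂ (Matrix (Fin L → Fin 2) (Fin L → Fin 2) ℂ)) *
          Ring.inverse (Tmono L η s (-z))) 0 0 +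
        -sinh (z + η - ξp) • (Tmono L η s z * (Kbdry ξm z).map (algebraMap ℂ (Matrix (Fin L → Fin 2) (Fin L → Fin 2) ℂ)) *
          Ring.inverse (Tmono L η s (-z))) 1 1) := by
  rw [transfer, mul_assoc, mul_assoc, ← mul_assoc (Tmono L η s z)]
  generalize Tmono L η s z * (Kbdry ξm z).map (algebraMap ℂ (Matrix (Fin L → Fin 2) (Fin L → Fin 2) ℂ)) *
          Ring.inverse (Tmono L η s (-z)) = U
  simp [Matrix.trace, Fin.sum_univ_two, Matrix.mul_apply, Kplus, Kbdry,
    Algebra.algebraMap_eq_smul_one, smul_smul, mul_assoc]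

variable {L η s}

theorem transfer_commute_of_ne_zero (ξp ξm : ℂ) {u v : ℂ}
    (hu : IsUnit (Tmono L η s (-u))) (hv : IsUnit (Tmono L η s (-v)))
    (h : sinh (u + v) * sinh (u + v + 2 * η) * sinh (u - v + η) * sinh (u - v - η) ≠ 0) :
    transfer L η s ξp ξm u * transfer L η s ξp ξm v =
      transfer L η s ξp ξm v * transfer L η s ξp ξm u := by
  have key := (Tmono_yangBaxter L η s).reflection ξm u v
    (Ring.inverse_mul_cancel _ hu) (Ring.mul_inverse_cancel _ hu)
    (Ring.inverse_mul_cancel _ hv) (Ring.mul_inverse_cancel _ hv)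
  have := smul_right_injective _ h (reflection_trace_commute η ξp u v key)
  simp only [transfer_eq_smul, smul_mul_smul_comm]
  rw [mul_comm, this]

theorem continuousAt_transfer (ξp : ℂ) {ξm z : ℂ} (hξp : sinh ξp ≠ 0) (hξm : sinh ξm ≠ 0)
    (hz : cosh z ≠ 0) (hzη : cosh (z + η) ≠ 0) (hT : IsUnit (Tmono L η s (-z))) :
    ContinuousAt (transfer L η s ξp ξm) z := by
  have hmap : Continuous fun M : Matrix (Fin 2) (Fin 2) ℂ =>
      M.map (algebraMap ℂ (Matrix (Fin L → Fin 2) (Fin L → Fin 2) ℂ)) :=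
    continuous_id.matrix_map (continuous_algebraMap _ _)
  have hKp : ContinuousAt (Kplus η ξp) z :=
    ((continuousAt_Kbdry hξp hzη).comp (f := (· + η))
      (continuous_add_const η).continuousAt).const_smul (2 : ℂ)⁻¹
  have hinv : ContinuousAt (fun x => Ring.inverse (Tmono L η s (-x))) z :=
    (continuousAt_ringInverse_Tmono L η s hT).comp continuous_neg.continuousAt
  exact continuous_id.matrix_trace.continuousAt.comp
    ((((hmap.continuousAt.comp hKp).mul (continuous_Tmono L η s).continuousAt).mul
      (hmap.continuousAt.comp (continuousAt_Kbdry hξm hz))).mul hinv)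

end Transfer

theorem eventually_sinh_add_ne_zero (c x : ℂ) : ∀ᶠ z in nhdsWithin x {x}ᶜ, sinh (z + c) ≠ 0 := by
  by_cases hx : cosh (x + c) = 0
  · have : sinh (x + c) ≠ 0 := fun h => by
      simpa [h, hx] using cosh_sq (x + c)
    exact ((continuous_sinh.comp (continuous_add_const c)).continuousAt.eventually_ne
      this).filter_mono nhdsWithin_le_nhds
  · exact ((hasDerivAt_sinh (x + c)).comp_add_const x c).eventually_ne hx

/-- The open-chain transfer matrices form a commuting family. -/
theorem transfer_commute (L : ℕ) (η : ℂ) (s : Fin L → ℂ) (ξp ξm : ℂ)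
    (hξp : sinh ξp ≠ 0) (hξm : sinh ξm ≠ 0) (lam μ : ℂ)
    (h1 : cosh lam ≠ 0) (h2 : cosh μ ≠ 0)
    (h3 : cosh (lam + η) ≠ 0) (h4 : cosh (μ + η) ≠ 0)
    (h5 : IsUnit (Tmono L η s (-lam))) (h6 : IsUnit (Tmono L η s (-μ))) :
    transfer L η s ξp ξm lam * transfer L η s ξp ξm μ =
      transfer L η s ξp ξm μ * transfer L η s ξp ξm lam := by
  have hc := continuousAt_transfer ξp hξp hξm h1 h3 h5
  have hU : ∀ᶠ z in nhds lam, IsUnit (Tmono L η s (-z)) := by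
    simp only [isUnit_Tmono_iff] at h5 ⊢
    exact ((continuous_Tfull L η s).comp continuous_neg).matrix_det.continuousAt.eventually_ne h5
  refine tendsto_nhds_unique_of_eventuallyEq (l := nhdsWithin lam {lam}ᶜ)
    ((hc.mul continuousAt_const).mono_left nhdsWithin_le_nhds)
    ((continuousAt_const.mul hc).mono_left nhdsWithin_le_nhds) ?_
  filter_upwards [hU.filter_mono nhdsWithin_le_nhds, eventually_sinh_add_ne_zero μ lam,
    eventually_sinh_add_ne_zero (μ + 2 * η) lam, eventually_sinh_add_ne_zero (-μ + η) lam,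
    eventually_sinh_add_ne_zero (-μ - η) lam] with z hz z1 z2 z3 z4
  refine transfer_commute_of_ne_zero ξp ξm hz h6 ?_
  simp only [← add_assoc, add_sub_assoc', ← sub_eq_add_neg] at z2 z3 z4
  exact mul_ne_zero (mul_ne_zero (mul_ne_zero z1 z2) z3) z4
end

section
/- For every λ ∈ ℂ the quantum determinant of the monodromy matrix is the scalar a(λ+η/2)·d(λ−η/2): as operators on (ℂ²)^{⊗L}, A(λ+η/2)·D(λ−η/2) − B(λ+η/2)·C(λ−η/2) = a(λ+η/2)·d(λ−η/2) · id. -/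
open Complex Matrix

/-- The operator on `(ℂ²)^{⊗L}` acting by `X` on the `j`-th factor. -/
def siteOp {L : ℕ} (j : Fin L) (X : Matrix (Fin 2) (Fin 2) ℂ) :
    Matrix (Fin L → Fin 2) (Fin L → Fin 2) ℂ :=
  Matrix.of fun v w => X (v j) (w j) * (if ∀ k, k ≠ j → v k = w k then 1 else 0)

/-- The `(a, b)` entry of an operator on `ℂ² ⊗ V`, as an operator on `V`. -/
def auxBlock {V : Type*} (M : Matrix (Fin 2 × V) (Fin 2 × V) ℂ) (a b : Fin 2) :
    Matrix V V ℂ :=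
  Matrix.of fun v w => M (a, v) (b, w)

lemma auxBlock_mul {V : Type*} [Fintype V] (M N : Matrix (Fin 2 × V) (Fin 2 × V) ℂ)
    (a b : Fin 2) :
    auxBlock (M * N) a b =
      auxBlock M a 0 * auxBlock N 0 b + auxBlock M a 1 * auxBlock N 1 b := by
  ext v w
  simp [auxBlock, Matrix.mul_apply, Fintype.sum_prod_type, Fin.sum_univ_two]

lemma auxBlock_one {V : Type*} [DecidableEq V] (a b : Fin 2) :
    auxBlock (1 : Matrix (Fin 2 × V) (Fin 2 × V) ℂ) a b = if a = b then 1 else 0 := by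
  ext v w
  by_cases h : a = b <;> simp [auxBlock, Matrix.one_apply, h]

lemma auxBlock_R0j (L : ℕ) (η lam : ℂ) (j : Fin L) (a b : Fin 2) :
    auxBlock (R0j L η lam j) a b = siteOp j (auxBlock (R6v η lam) a b) := rfl

section siteOp

variable {L : ℕ} (j : Fin L)

lemma siteOp_apply_eq_sum (X : Matrix (Fin 2) (Fin 2) ℂ) (v w : Fin L → Fin 2) :
    siteOp j X v w =
      ∑ c, X (v j) c * (if Function.update v j c = w then 1 else 0) := by
  have key (c : Fin 2) : Function.update v j c = w ↔
      c = w j ∧ ∀ k, k ≠ j → v k = w k := Function.update_eq_iff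
  simp only [key, siteOp, Matrix.of_apply, ite_and]
  simp

lemma siteOp_mul_apply (X : Matrix (Fin 2) (Fin 2) ℂ)
    (M : Matrix (Fin L → Fin 2) (Fin L → Fin 2) ℂ) (v z : Fin L → Fin 2) :
    (siteOp j X * M) v z = ∑ c, X (v j) c * M (Function.update v j c) z := by
  simp only [Matrix.mul_apply, siteOp_apply_eq_sum, Finset.sum_mul]
  rw [Finset.sum_comm]
  simp

lemma siteOp_mul (X Y : Matrix (Fin 2) (Fin 2) ℂ) :
    siteOp j X * siteOp j Y = siteOp j (X * Y) := by
  ext v z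
  rw [siteOp_mul_apply]
  simp only [siteOp_apply_eq_sum, Matrix.mul_apply, Finset.sum_mul, Finset.mul_sum,
    mul_assoc, Function.update_self, Function.update_idem]
  exact Finset.sum_comm

lemma siteOp_sub (X Y : Matrix (Fin 2) (Fin 2) ℂ) :
    siteOp j X - siteOp j Y = siteOp j (X - Y) := by
  ext v z
  simp only [siteOp, Matrix.sub_apply, Matrix.of_apply, sub_mul]

lemma siteOp_smul_one (c : ℂ) : siteOp j (c • 1) = c • 1 := by
  ext v z
  have h : v = z ↔ v j = z j ∧ ∀ k, k ≠ j → v k = z k :=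
    ⟨by rintro rfl; simp, fun h => funext fun k => by
      by_cases hk : k = j
      · exact hk ▸ h.1
      · exact h.2 k hk⟩
  simp only [siteOp, Matrix.of_apply, Matrix.smul_apply, Matrix.one_apply, h, ite_and]
  by_cases h1 : v j = z j <;> simp [h1]

lemma siteOp_commute {j k : Fin L} (hjk : j ≠ k) (X Y : Matrix (Fin 2) (Fin 2) ℂ) :
    Commute (siteOp j X) (siteOp k Y) := by
  ext v z
  simp only [siteOp_mul_apply, siteOp_apply_eq_sum, Function.update_of_ne hjk,
    Function.update_of_ne hjk.symm, Finset.mul_sum]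
  rw [Finset.sum_comm]
  refine Finset.sum_congr rfl fun d _ => Finset.sum_congr rfl fun c _ => ?_
  rw [Function.update_comm hjk]
  ring

end siteOp

/-- The antisymmetric symbol on `ℂ²`. -/
def leviCivita : Matrix (Fin 2) (Fin 2) ℂ := !![0, 1; -1, 0]

lemma R6v_quantum_determinant (η x : ℂ) (a b : Fin 2) :
    auxBlock (R6v η (x + η)) a 0 * auxBlock (R6v η x) b 1 -
        auxBlock (R6v η (x + η)) a 1 * auxBlock (R6v η x) b 0 =
      (leviCivita a b * (sinh (x + η + η) * sinh x)) • 1 := by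
  have key : sinh (x + η) * sinh (x + η) - sinh η * sinh η =
      sinh (x + η + η) * sinh x := by
    simp only [sinh_add, cosh_add]
    linear_combination sinh η ^ 2 * cosh_sq_sub_sinh_sq x
  ext v w
  fin_cases a <;> fin_cases b <;> fin_cases v <;> fin_cases w <;>
    simp [auxBlock, R6v, leviCivita, Matrix.mul_apply, Fin.sum_univ_two] <;>
    first | ring1 | linear_combination key | linear_combination -key

/-- Product of the `R`-matrices `R_{0j}(λ - s_j)` over a list of sites `j`. -/
noncomputable def listMonodromy (L : ℕ) (η : ℂ) (s : Fin L → ℂ) (l : List (Fin L)) (lam : ℂ) :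
    Matrix (Fin 2 × (Fin L → Fin 2)) (Fin 2 × (Fin L → Fin 2)) ℂ :=
  (l.map fun j => R0j L η (lam - s j) j).prod

lemma siteOp_commute_listMonodromy {L : ℕ} (η : ℂ) (s : Fin L → ℂ) (lam : ℂ) {j : Fin L}
    (X : Matrix (Fin 2) (Fin 2) ℂ) {l : List (Fin L)} (hj : j ∉ l) (a b : Fin 2) :
    Commute (siteOp j X) (auxBlock (listMonodromy L η s l lam) a b) := by
  induction l generalizing a with
  | nil =>
    simp only [listMonodromy, List.map_nil, List.prod_nil, auxBlock_one]
    split_ifs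
    · exact Commute.one_right _
    · exact Commute.zero_right _
  | cons k l ih =>
    rw [List.mem_cons, not_or] at hj
    simp only [listMonodromy, List.map_cons, List.prod_cons, auxBlock_mul, auxBlock_R0j]
    exact ((siteOp_commute hj.1 _ _).mul_right (ih hj.2 0)).add_right
      ((siteOp_commute hj.1 _ _).mul_right (ih hj.2 1))

lemma listMonodromy_quantum_determinant {L : ℕ} (η : ℂ) (s : Fin L → ℂ) (lam : ℂ)
    {l : List (Fin L)} (hl : l.Nodup) (a b : Fin 2) :
    auxBlock (listMonodromy L η s l (lam + η)) a 0 * auxBlock (listMonodromy L η s l lam) b 1 -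
        auxBlock (listMonodromy L η s l (lam + η)) a 1 *
          auxBlock (listMonodromy L η s l lam) b 0 =
      (leviCivita a b *
        (l.map fun j => sinh (lam + η - s j + η) * sinh (lam - s j)).prod) • 1 := by
  induction l generalizing a b with
  | nil =>
    fin_cases a <;> fin_cases b <;> simp [listMonodromy, auxBlock_one, leviCivita]
  | cons j l ih =>
    obtain ⟨hj, hl⟩ := List.nodup_cons.1 hl
    have comm (c d e f : Fin 2) := (siteOp_commute_listMonodromy η s (lam + η)
      (auxBlock (R6v η (lam - s j)) c d) hj e f).eq
    have loc : siteOp j (auxBlock (R6v η (lam + η - s j)) a 0) *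
          siteOp j (auxBlock (R6v η (lam - s j)) b 1) -
        siteOp j (auxBlock (R6v η (lam + η - s j)) a 1) *
          siteOp j (auxBlock (R6v η (lam - s j)) b 0) =
        (leviCivita a b * (sinh (lam + η - s j + η) * sinh (lam - s j))) • 1 := by
      have h := R6v_quantum_determinant η (lam - s j) a b
      rw [show lam - s j + η = lam + η - s j by ring] at h
      rw [siteOp_mul, siteOp_mul, siteOp_sub, h, siteOp_smul_one]
    have exch (P Q M N : Matrix (Fin L → Fin 2) (Fin L → Fin 2) ℂ) (h : Q * M = M * Q) :
        P * M * (Q * N) = P * Q * (M * N) := by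
      rw [mul_assoc, ← mul_assoc M, ← h, mul_assoc, mul_assoc]
    have expand (p : Fin 2) (q : Fin 2) :
        auxBlock (listMonodromy L η s (j :: l) (lam + η)) a p *
          auxBlock (listMonodromy L η s (j :: l) lam) b q =
        ∑ c, ∑ d, siteOp j (auxBlock (R6v η (lam + η - s j)) a c) *
          siteOp j (auxBlock (R6v η (lam - s j)) b d) *
          (auxBlock (listMonodromy L η s l (lam + η)) c p *
            auxBlock (listMonodromy L η s l lam) d q) := by
      simp only [← exch _ _ _ _ (comm _ _ _ _), Fin.sum_univ_two]
      simp only [listMonodromy, List.map_cons, List.prod_cons, auxBlock_mul, auxBlock_R0j,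
        add_mul, mul_add]
      abel
    have reduce :
        auxBlock (listMonodromy L η s (j :: l) (lam + η)) a 0 *
            auxBlock (listMonodromy L η s (j :: l) lam) b 1 -
          auxBlock (listMonodromy L η s (j :: l) (lam + η)) a 1 *
            auxBlock (listMonodromy L η s (j :: l) lam) b 0 =
        ∑ c, ∑ d, siteOp j (auxBlock (R6v η (lam + η - s j)) a c) *
          siteOp j (auxBlock (R6v η (lam - s j)) b d) *
          (auxBlock (listMonodromy L η s l (lam + η)) c 0 *
              auxBlock (listMonodromy L η s l lam) d 1 -
            auxBlock (listMonodromy L η s l (lam + η)) c 1 *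
              auxBlock (listMonodromy L η s l lam) d 0) := by
      rw [expand, expand]
      simp only [mul_sub, Finset.sum_sub_distrib]
    rw [reduce]
    simp only [ih hl, Matrix.mul_smul, mul_one, List.map_cons, List.prod_cons]
    rw [← mul_assoc, mul_comm, mul_smul, ← loc]
    simp [Fin.sum_univ_two, leviCivita, sub_eq_add_neg]

/-- The quantum determinant of the monodromy matrix is the scalar
`a(λ+η/2)·d(λ−η/2)`:
`A(λ+η/2)·D(λ−η/2) − B(λ+η/2)·C(λ−η/2) = a(λ+η/2)·d(λ−η/2) · id`. -/
theorem quantum_determinant (L : ℕ) (η : ℂ) (s : Fin L → ℂ) (lam : ℂ) :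
    Tmono L η s (lam + η / 2) 0 0 * Tmono L η s (lam - η / 2) 1 1 -
        Tmono L η s (lam + η / 2) 0 1 * Tmono L η s (lam - η / 2) 1 0 =
      (afun η s (lam + η / 2) * dfun s (lam - η / 2)) •
        (1 : Matrix (Fin L → Fin 2) (Fin L → Fin 2) ℂ) := by
  have hT (μ : ℂ) (a b : Fin 2) : Tmono L η s μ a b =
      auxBlock (listMonodromy L η s (List.finRange L).reverse μ) a b := rfl
  have h := listMonodromy_quantum_determinant η s (lam - η / 2)
    (List.nodup_reverse.2 (List.nodup_finRange L)) 0 1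
  rw [show lam - η / 2 + η = lam + η / 2 by ring] at h
  rw [hT, hT, hT, hT, h, List.map_reverse, List.prod_reverse, ← List.ofFn_eq_map,
    List.prod_ofFn, Finset.prod_mul_distrib]
  simp [leviCivita, afun, dfun]
end

section
/- Let m ≤ L and assume the operators t(s_j) := A(s_j) + D(s_j) are invertible in End((ℂ²)^{⊗L}) for j = 1,…,m. For α, β ∈ {1,2} let (E_m)_α^β ∈ End((ℂ²)^{⊗L}) be the operator acting as the elementary 2×2 matrix with a single 1 in row α and column β on the m-th tensor factor and as the identity on all other factors. Then the quantum inverse problem is solved by (E_m)_α^β = [ t(s₁)·t(s₂)⋯t(s_{m−1}) ] · T^β_α(s_m) · [ t(s₁)·t(s₂)⋯t(s_m) ]⁻¹, where T^β_α(λ) is the entry in row β and column α of T(λ) (so T¹₁ = A, T¹₂ = B, T²₁ = C, T²₂ = D). -/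
open Complex Matrix

/-- `(E_m)_α^β`: the operator acting as the elementary `2×2` matrix with a single `1`
in row `α` and column `β` on the `m`-th tensor factor of `(ℂ²)^{⊗L}` and as the
identity on all other factors. -/
noncomputable def siteE (L : ℕ) (m : Fin L) (α β : Fin 2) :
    Matrix (Fin L → Fin 2) (Fin L → Fin 2) ℂ :=
  Matrix.of fun v w =>
    (if v m = α then 1 else 0) * (if w m = β then 1 else 0) *
      (if ∀ k, k ≠ m → v k = w k then 1 else 0)

/-- The ordered product `t(s₁)·t(s₂)⋯t(s_k)` of the operators
`t(s_j) = A(s_j) + D(s_j)`. -/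
noncomputable def prodAD (L : ℕ) (η : ℂ) (s : Fin L → ℂ) (k : ℕ) :
    Matrix (Fin L → Fin 2) (Fin L → Fin 2) ℂ :=
  (((List.finRange L).take k).map
    (fun j => Tmono L η s (s j) 0 0 + Tmono L η s (s j) 1 1)).prod

section SiteOperators

variable {L : ℕ}

lemma siteE_apply (i : Fin L) (a b : Fin 2) (v w : Fin L → Fin 2) :
    siteE L i a b v w = if w = Function.update v i b then (if v i = a then 1 else 0) else 0 := by
  have h : w = Function.update v i b ↔ w i = b ∧ ∀ k, k ≠ i → v k = w k := by
    rw [Function.eq_update_iff]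
    simp only [eq_comm]
  simp only [siteE, of_apply, h]
  by_cases h1 : v i = a <;> by_cases h2 : w i = b <;> simp [h1, h2]

lemma siteE_mul_siteE (i : Fin L) (a b c d : Fin 2) :
    siteE L i a b * siteE L i c d = if b = c then siteE L i a d else 0 := by
  ext v w
  simp only [Matrix.mul_apply, siteE_apply, ite_mul, zero_mul, Finset.sum_ite_eq',
    Finset.mem_univ, if_true, Function.update_self, Function.update_idem]
  split_ifs <;> simp_all [siteE_apply]

lemma commute_siteE {i j : Fin L} (h : i ≠ j) (a b c d : Fin 2) :
    Commute (siteE L i a b) (siteE L j c d) := by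
  ext v w
  simp only [Matrix.mul_apply, siteE_apply, ite_mul, zero_mul, Finset.sum_ite_eq',
    Finset.mem_univ, if_true, Function.update_of_ne h,
    Function.update_of_ne h.symm, Function.update_comm h]
  split_ifs <;> simp

lemma siteE_zero_add_siteE_one (i : Fin L) : siteE L i 0 0 + siteE L i 1 1 = 1 := by
  ext v w
  rw [Matrix.add_apply, siteE_apply, siteE_apply, Matrix.one_apply]
  rcases Fin.exists_fin_two.1 ⟨v i, rfl⟩ with h | h
  · have h' : Function.update v i 0 = v := by rw [← h, Function.update_eq_self]
    simp [h', h, eq_comm]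
  · have h' : Function.update v i 1 = v := by rw [← h, Function.update_eq_self]
    simp [h', h, eq_comm]

end SiteOperators

section LocalOperators

variable {L : ℕ}

/-- The `L`-operator `R_{0j}(λ)` as a `2×2` matrix over the auxiliary space. -/
noncomputable def localOp (η lam : ℂ) (j : Fin L) :
    Matrix (Fin 2) (Fin 2) (Matrix (Fin L → Fin 2) (Fin L → Fin 2) ℂ) :=
  (Matrix.compRingEquiv (Fin 2) (Fin L → Fin 2) ℂ).symm (R0j L η lam j)

lemma localOp_eq (η lam : ℂ) (j : Fin L) :
    localOp η lam j =
      !![sinh (lam + η) • siteE L j 0 0 + sinh lam • siteE L j 1 1, sinh η • siteE L j 1 0;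
        sinh η • siteE L j 0 1, sinh lam • siteE L j 0 0 + sinh (lam + η) • siteE L j 1 1] := by
  ext a b v w
  have h : localOp η lam j a b v w = R0j L η lam j (a, v) (b, w) := rfl
  rw [h]
  simp only [R0j, R6v, of_apply]
  obtain hv | hv := Fin.exists_fin_two.1 ⟨v j, rfl⟩ <;>
    obtain hw | hw := Fin.exists_fin_two.1 ⟨w j, rfl⟩ <;>
    fin_cases a <;> fin_cases b <;> simp [siteE, hv, hw]

lemma Tmono_eq_prod (η : ℂ) (s : Fin L → ℂ) (lam : ℂ) :
    Tmono L η s lam = ((List.finRange L).reverse.map fun j => localOp η (lam - s j) j).prod := by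
  have h : Tmono L η s lam =
      (Matrix.compRingEquiv (Fin 2) (Fin L → Fin 2) ℂ).symm (Tfull L η s lam) := rfl
  rw [h, Tfull, map_list_prod, List.map_map]
  rfl

lemma commute_localOp_apply {η lam : ℂ} {j : Fin L}
    {z : Matrix (Fin L → Fin 2) (Fin L → Fin 2) ℂ} (h : ∀ a b, Commute (siteE L j a b) z)
    (a b : Fin 2) : Commute (localOp η lam j a b) z := by
  rw [localOp_eq]
  fin_cases a <;> fin_cases b <;>
    simp [Commute.add_left, Commute.smul_left, h]

lemma localOp_mul_localOp_neg (η lam : ℂ) (j : Fin L) :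
    localOp η lam j * localOp η (-lam) j = (sinh (lam + η) * sinh (-lam + η)) • 1 := by
  have h : sinh (lam + η) * sinh (-lam + η) = sinh η ^ 2 - sinh lam ^ 2 := by
    rw [sinh_add, sinh_add, sinh_neg, cosh_neg]
    linear_combination sinh η ^ 2 * cosh_sq lam - sinh lam ^ 2 * cosh_sq η
  rw [localOp_eq, localOp_eq, Matrix.one_fin_two, ← siteE_zero_add_siteE_one j]
  ext1 a b
  fin_cases a <;> fin_cases b <;>
    simp [Matrix.mul_apply, Fin.sum_univ_two, add_mul, mul_add, siteE_mul_siteE, smul_smul, h,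
      mul_comm (sinh (-lam + η))] <;>
    module

/-- The operator on the quantum space obtained by letting the auxiliary space act on site `i`. -/
noncomputable def auxToSite (i : Fin L)
    (X : Matrix (Fin 2) (Fin 2) (Matrix (Fin L → Fin 2) (Fin L → Fin 2) ℂ)) :
    Matrix (Fin L → Fin 2) (Fin L → Fin 2) ℂ :=
  ∑ a, ∑ b, siteE L i a b * X a b

lemma auxToSite_mul (i : Fin L)
    {X : Matrix (Fin 2) (Fin 2) (Matrix (Fin L → Fin 2) (Fin L → Fin 2) ℂ)}
    (hX : ∀ a b c d, Commute (X a b) (siteE L i c d))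
    (Y : Matrix (Fin 2) (Fin 2) (Matrix (Fin L → Fin 2) (Fin L → Fin 2) ℂ)) :
    auxToSite i (X * Y) = auxToSite i X * auxToSite i Y := by
  have h : ∀ a b c d, siteE L i a b * X a b * (siteE L i c d * Y c d) =
      if b = c then siteE L i a d * (X a b * Y c d) else 0 := by
    intro a b c d
    rw [mul_assoc, ← mul_assoc (X a b), (hX a b c d).eq, mul_assoc, ← mul_assoc (siteE L i a b),
      siteE_mul_siteE, ite_mul, zero_mul]
  simp only [auxToSite, Fin.sum_univ_two, Matrix.mul_apply, add_mul, mul_add, h]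
  simp
  abel

lemma auxToSite_smul_one (i : Fin L) (c : ℂ) : auxToSite i (c • 1) = c • 1 := by
  simp [auxToSite, Fin.sum_univ_two, ← smul_add, siteE_zero_add_siteE_one]

lemma commute_auxToSite {i : Fin L}
    {X : Matrix (Fin 2) (Fin 2) (Matrix (Fin L → Fin 2) (Fin L → Fin 2) ℂ)}
    {z : Matrix (Fin L → Fin 2) (Fin L → Fin 2) ℂ} (hi : ∀ a b, Commute (siteE L i a b) z)
    (hX : ∀ a b, Commute (X a b) z) : Commute (auxToSite i X) z :=
  Commute.sum_left _ _ _ fun a _ => Commute.sum_left _ _ _ fun b _ => (hi a b).mul_left (hX a b)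

lemma auxToSite_localOp_comm (η lam : ℂ) {i j : Fin L} (h : i ≠ j) :
    auxToSite i (localOp η lam j) = auxToSite j (localOp η lam i) := by
  have hc := fun a b c d => (commute_siteE h.symm a b c d).eq
  simp only [auxToSite, Fin.sum_univ_two, localOp_eq]
  simp [mul_add, hc]
  abel

lemma auxToSite_mul_auxToSite_swap (η lam : ℂ) {i j : Fin L} (h : i ≠ j) :
    auxToSite i (localOp η lam j) * auxToSite j (localOp η (-lam) i) =
      (sinh (lam + η) * sinh (-lam + η)) • 1 := by
  rw [← auxToSite_localOp_comm _ _ h, ← auxToSite_mul, localOp_mul_localOp_neg, auxToSite_smul_one]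
  exact fun a b c d => commute_localOp_apply (fun a b => commute_siteE h.symm a b c d) a b

end LocalOperators

section Monodromy

variable {L : ℕ}

/-- The ordered product of the `L`-operators of the sites in a list, the last site leftmost. -/
noncomputable def partialMono (η : ℂ) (s : Fin L → ℂ) (l : List (Fin L)) (lam : ℂ) :
    Matrix (Fin 2) (Fin 2) (Matrix (Fin L → Fin 2) (Fin L → Fin 2) ℂ) :=
  (l.reverse.map fun j => localOp η (lam - s j) j).prod

lemma partialMono_append (η : ℂ) (s : Fin L → ℂ) (l l' : List (Fin L)) (lam : ℂ) :
    partialMono η s (l ++ l') lam = partialMono η s l' lam * partialMono η s l lam := by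
  simp [partialMono]

lemma partialMono_singleton (η : ℂ) (s : Fin L → ℂ) (j : Fin L) (lam : ℂ) :
    partialMono η s [j] lam = localOp η (lam - s j) j := by
  simp [partialMono]

lemma commute_partialMono_apply {η : ℂ} {s : Fin L → ℂ} {l : List (Fin L)} {lam : ℂ}
    {z : Matrix (Fin L → Fin 2) (Fin L → Fin 2) ℂ}
    (h : ∀ j ∈ l, ∀ a b, Commute (siteE L j a b) z) (a b : Fin 2) :
    Commute (partialMono η s l lam a b) z := by
  induction l generalizing a b with
  | nil =>
    by_cases hab : a = b <;> simp [partialMono, hab]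
  | cons j l ih =>
    rw [← List.singleton_append, partialMono_append, partialMono_singleton, Matrix.mul_apply]
    refine Commute.sum_left _ _ _ fun c _ => Commute.mul_left ?_ ?_
    · exact ih (fun k hk => h k (List.mem_cons_of_mem _ hk)) a c
    · exact commute_localOp_apply (h j List.mem_cons_self) c b

lemma commute_partialMono_siteE {η : ℂ} {s : Fin L → ℂ} {l : List (Fin L)} {lam : ℂ}
    {i : Fin L} (hi : i ∉ l) (a b c d : Fin 2) :
    Commute (partialMono η s l lam a b) (siteE L i c d) :=
  commute_partialMono_apply
    (fun _ hj a b => commute_siteE (ne_of_mem_of_not_mem hj hi) a b c d) a b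

lemma notMem_take_finRange (k : Fin L) {n : ℕ} (h : n ≤ k) :
    k ∉ (List.finRange L).take n := by
  intro hk
  obtain ⟨i, hi, rfl⟩ := List.mem_iff_getElem.1 hk
  simp at hi h
  omega

lemma notMem_drop_finRange (k : Fin L) {n : ℕ} (h : k < n) :
    k ∉ (List.finRange L).drop n := by
  intro hk
  obtain ⟨i, hi, rfl⟩ := List.mem_iff_getElem.1 hk
  simp at hi h

lemma drop_finRange (k : Fin L) :
    (List.finRange L).drop k = [k] ++ (List.finRange L).drop (k + 1) := by
  rw [List.drop_eq_getElem_cons (by simp)]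
  simp

lemma take_finRange_succ (k : Fin L) :
    (List.finRange L).take (k + 1) = (List.finRange L).take k ++ [k] := by
  rw [List.take_succ_eq_append_getElem (by simp)]
  simp

lemma Tmono_self_apply (η : ℂ) (s : Fin L → ℂ) (k : Fin L) (α β : Fin 2) :
    Tmono L η s (s k) β α = sinh η •
      (auxToSite k (partialMono η s ((List.finRange L).take k) (s k)) * siteE L k α β *
        auxToSite k (partialMono η s ((List.finRange L).drop (k + 1)) (s k))) := by
  have hT : Tmono L η s (s k) = partialMono η s ((List.finRange L).drop (k + 1)) (s k) *
      localOp η 0 k * partialMono η s ((List.finRange L).take k) (s k) := by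
    rw [Tmono_eq_prod]
    change partialMono η s (List.finRange L) (s k) = _
    conv_lhs => rw [← List.take_append_drop k (List.finRange L), drop_finRange]
    rw [partialMono_append, partialMono_append, partialMono_singleton, sub_self]
  have hP : ∀ a b, localOp η 0 k a b = sinh η • siteE L k b a := by
    intro a b
    rw [localOp_eq]
    fin_cases a <;> fin_cases b <;> simp
  have hXE : ∀ a b c d,
      Commute (partialMono η s ((List.finRange L).drop (k + 1)) (s k) a b) (siteE L k c d) :=
    fun a b c d => commute_partialMono_siteE (notMem_drop_finRange k (by simp)) a b c d
  have hYE : ∀ a b c d,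
      Commute (partialMono η s ((List.finRange L).take k) (s k) a b) (siteE L k c d) :=
    fun a b c d => commute_partialMono_siteE (notMem_take_finRange k le_rfl) a b c d
  have hXY : ∀ a b c d,
      Commute (partialMono η s ((List.finRange L).drop (k + 1)) (s k) a b)
        (partialMono η s ((List.finRange L).take k) (s k) c d) := by
    intro a b c d
    refine commute_partialMono_apply (fun j hj a b => (commute_partialMono_siteE ?_ c d a b).symm)
      a b
    refine notMem_take_finRange j ?_
    by_contra! hlt
    exact notMem_drop_finRange j (hlt.trans (Nat.lt_succ_self _)) hj
  rw [hT]
  generalize partialMono η s ((List.finRange L).drop (k + 1)) (s k) = X at *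
  generalize partialMono η s ((List.finRange L).take k) (s k) = Y at *
  have hl : ∀ c d, X β c * (sinh η • siteE L k d c) * Y d α =
      sinh η • (siteE L k d c * (Y d α * X β c)) := by
    intro c d
    rw [mul_smul_comm, smul_mul_assoc, (hXE _ _ _ _).eq, mul_assoc, (hXY _ _ _ _).eq]
  have hr : ∀ d a b c, siteE L k d a * Y d a * siteE L k α β * (siteE L k b c * X b c) =
      if a = α ∧ β = b then siteE L k d c * (Y d a * X b c) else 0 := by
    intro d a b c
    rw [mul_assoc (siteE L k d a), (hYE d a α β).eq, ← mul_assoc (siteE L k d a),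
      siteE_mul_siteE]
    by_cases h1 : a = α
    · rw [if_pos h1, mul_assoc, ← mul_assoc (Y d a), (hYE d a b c).eq, mul_assoc (siteE L k b c),
        ← mul_assoc, siteE_mul_siteE]
      simp [h1]
    · simp [h1]
  simp only [Matrix.mul_apply, Finset.sum_mul, hP, hl, auxToSite, Finset.mul_sum, hr,
    Finset.smul_sum]
  fin_cases α <;> fin_cases β <;> simp [Fin.sum_univ_two] <;> abel

lemma trace_Tmono_self (η : ℂ) (s : Fin L → ℂ) (k : Fin L) :
    Tmono L η s (s k) 0 0 + Tmono L η s (s k) 1 1 = sinh η •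
      (auxToSite k (partialMono η s ((List.finRange L).take k) (s k)) *
        auxToSite k (partialMono η s ((List.finRange L).drop (k + 1)) (s k))) := by
  rw [Tmono_self_apply, Tmono_self_apply, ← smul_add, ← add_mul, ← mul_add,
    siteE_zero_add_siteE_one, mul_one]

/-- The ordered product over the first `n` sites `j` of the operators obtained by letting the
auxiliary space of the monodromy of the sites from `k` on act on site `j`. -/
noncomputable def tailProd (η : ℂ) (s : Fin L → ℂ) (k n : ℕ) :
    Matrix (Fin L → Fin 2) (Fin L → Fin 2) ℂ :=
  (((List.finRange L).take n).map fun j =>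
    auxToSite j (partialMono η s ((List.finRange L).drop k) (s j))).prod

lemma tailProd_succ (η : ℂ) (s : Fin L → ℂ) (k : ℕ) (n : Fin L) :
    tailProd η s k (n + 1) = tailProd η s k n *
      auxToSite n (partialMono η s ((List.finRange L).drop k) (s n)) := by
  simp [tailProd, take_finRange_succ]

lemma exists_tailProd_mul (η : ℂ) (s : Fin L → ℂ) (k : Fin L) (n : ℕ) (hn : n ≤ k) :
    ∃ c : ℂ, tailProd η s k n *
      auxToSite k (partialMono η s ((List.finRange L).take n) (s k)) =
        c • tailProd η s (k + 1) n := by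
  induction n with
  | zero =>
    refine ⟨1, ?_⟩
    simpa [tailProd, partialMono] using auxToSite_smul_one k 1
  | succ n ih =>
    obtain ⟨c, hc⟩ := ih (by omega)
    have hnL : n < L := by omega
    obtain ⟨i, rfl⟩ : ∃ i : Fin L, n = i := ⟨⟨n, hnL⟩, rfl⟩
    have hik : i ≠ k := by
      rintro rfl
      omega
    have hX : auxToSite i (partialMono η s ((List.finRange L).drop k) (s i)) =
        auxToSite i (partialMono η s ((List.finRange L).drop (k + 1)) (s i)) *
          auxToSite i (localOp η (s i - s k) k) := by
      rw [drop_finRange, partialMono_append, partialMono_singleton, auxToSite_mul]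
      exact commute_partialMono_siteE (notMem_drop_finRange i (by omega))
    have hY : auxToSite k (partialMono η s ((List.finRange L).take (i + 1)) (s k)) =
        auxToSite k (localOp η (-(s i - s k)) i) *
          auxToSite k (partialMono η s ((List.finRange L).take i) (s k)) := by
      rw [take_finRange_succ, partialMono_append, partialMono_singleton, auxToSite_mul, neg_sub]
      exact fun a b c d => commute_localOp_apply (fun a b => commute_siteE hik a b c d) a b
    have hcomm : Commute
        (auxToSite i (partialMono η s ((List.finRange L).drop (k + 1)) (s i)))
        (auxToSite k (partialMono η s ((List.finRange L).take i) (s k))) := by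
      have key : ∀ j : Fin L, j ≠ k → (i : ℕ) ≤ j → ∀ a b, Commute (siteE L j a b)
          (auxToSite k (partialMono η s ((List.finRange L).take i) (s k))) :=
        fun j hjk hij a b => (commute_auxToSite (fun c d => commute_siteE hjk.symm c d a b)
          fun c d => commute_partialMono_siteE (notMem_take_finRange j hij) c d a b).symm
      refine commute_auxToSite (key i hik le_rfl) (commute_partialMono_apply fun j hj => ?_)
      have hkj : (k : ℕ) < j := by
        by_contra! hle
        exact notMem_drop_finRange j (Nat.lt_succ_of_le hle) hj
      exact key j (fun h => by simp [h] at hkj) (by omega)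
    refine ⟨sinh (s i - s k + η) * sinh (-(s i - s k) + η) * c, ?_⟩
    rw [tailProd_succ, tailProd_succ, hX, hY, mul_assoc, mul_assoc,
      ← mul_assoc (auxToSite i (localOp η (s i - s k) k)), auxToSite_mul_auxToSite_swap _ _ hik,
      smul_mul_assoc, one_mul, mul_smul_comm, hcomm.eq, mul_smul_comm, ← mul_assoc, hc,
      smul_mul_assoc, smul_smul]

lemma prodAD_succ (η : ℂ) (s : Fin L → ℂ) (k : Fin L) :
    prodAD L η s (k + 1) =
      prodAD L η s k * (Tmono L η s (s k) 0 0 + Tmono L η s (s k) 1 1) := by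
  simp [prodAD, take_finRange_succ]

lemma exists_prodAD_eq (η : ℂ) (s : Fin L → ℂ) (n : ℕ) (hn : n ≤ L) :
    ∃ c : ℂ, prodAD L η s n = c • tailProd η s n n := by
  induction n with
  | zero => exact ⟨1, by simp [prodAD, tailProd]⟩
  | succ n ih =>
    obtain ⟨c, hc⟩ := ih (by omega)
    obtain ⟨k, rfl⟩ : ∃ k : Fin L, n = k := ⟨⟨n, hn⟩, rfl⟩
    obtain ⟨c', hc'⟩ := exists_tailProd_mul η s k k le_rfl
    refine ⟨c * (sinh η * c'), ?_⟩
    rw [prodAD_succ, hc, trace_Tmono_self, tailProd_succ, smul_mul_assoc, mul_smul_comm,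
      ← mul_assoc, hc', smul_mul_assoc, smul_smul, smul_smul, mul_assoc c]

lemma commute_tailProd_siteE (η : ℂ) (s : Fin L → ℂ) (k : Fin L) (a b : Fin 2) :
    Commute (tailProd η s (k + 1) k) (siteE L k a b) := by
  refine Commute.list_prod_left _ _ fun x hx => ?_
  obtain ⟨j, hj, rfl⟩ := List.mem_map.1 hx
  refine commute_auxToSite (fun c d => commute_siteE ?_ c d a b)
    fun c d => commute_partialMono_siteE (notMem_drop_finRange k (by simp)) c d a b
  rintro rfl
  exact notMem_take_finRange j le_rfl hj

lemma siteE_mul_prodAD (η : ℂ) (s : Fin L → ℂ) (k : Fin L) (α β : Fin 2) :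
    siteE L k α β * prodAD L η s (k + 1) = prodAD L η s k * Tmono L η s (s k) β α := by
  obtain ⟨c, hc⟩ := exists_prodAD_eq η s k k.2.le
  obtain ⟨c', hc'⟩ := exists_tailProd_mul η s k k le_rfl
  rw [prodAD_succ, hc, trace_Tmono_self, Tmono_self_apply]
  simp only [smul_mul_assoc, mul_smul_comm, ← mul_assoc]
  rw [hc', mul_assoc (siteE L k α β), hc']
  simp only [smul_mul_assoc, mul_smul_comm, (commute_tailProd_siteE η s k α β).eq]

end Monodromy

/-- Solution of the quantum inverse problem:
`(E_m)_α^β = [t(s₁)⋯t(s_{m−1})] · T^β_α(s_m) · [t(s₁)⋯t(s_m)]⁻¹`,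
where `T^β_α(λ)` is the entry of the monodromy matrix in row `β` and column `α`. -/
theorem quantum_inverse_problem (L : ℕ) (η : ℂ) (s : Fin L → ℂ)
    (m : ℕ) (h1 : 1 ≤ m) (hm : m ≤ L)
    (hu : ∀ j : Fin L, (j : ℕ) < m →
      IsUnit (Tmono L η s (s j) 0 0 + Tmono L η s (s j) 1 1))
    (α β : Fin 2) :
    siteE L ⟨m - 1, by omega⟩ α β =
      prodAD L η s (m - 1) * Tmono L η s (s ⟨m - 1, by omega⟩) β α *
        Ring.inverse (prodAD L η s m) := by
  obtain ⟨n, rfl⟩ : ∃ n, m = n + 1 := ⟨m - 1, by omega⟩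
  have hunit : IsUnit (prodAD L η s (n + 1)) := by
    refine List.prod_isUnit fun x hx => ?_
    obtain ⟨j, hj, rfl⟩ := List.mem_map.1 hx
    refine hu j ?_
    by_contra! hle
    exact notMem_take_finRange j hle hj
  rw [Ring.eq_mul_inverse_iff_mul_eq _ _ _ hunit]
  exact siteE_mul_prodAD η s ⟨n, hm⟩ α β
end

section
/- For every z ∈ ℂ at which all hyperbolic sine factors occurring in the numerators and denominators of 𝔞(z) and of 𝔞(−z) are nonzero, the auxiliary function satisfies 𝔞(z) · 𝔞(−z) = 1. In particular, if 1 + 𝔞(z) = 0 then 1 + 𝔞(−z) = 0, so the solutions of the equation 1 + 𝔞 = 0 are symmetric with respect to the origin. -/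
open Complex

/-- `q(z) = ∏_{l=1}^M sinh(z−λ_l)·sinh(z+λ_l)`. -/
noncomputable def qfun {M : ℕ} (lv : Fin M → ℂ) (z : ℂ) : ℂ :=
  ∏ l, sinh (z - lv l) * sinh (z + lv l)

/-- The auxiliary function `𝔞(z)` of the open XXZ chain. -/
noncomputable def auxA (η ξp ξm : ℂ) {L M : ℕ} (s : Fin L → ℂ) (lv : Fin M → ℂ)
    (z : ℂ) : ℂ :=
  (sinh (z - ξp + η / 2) * sinh (z - ξm + η / 2) /
      (sinh (z + ξp - η / 2) * sinh (z + ξm - η / 2))) *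
    (sinh (2 * z - η) / sinh (2 * z + η)) *
    (∏ l, sinh (z - η / 2 + s l) * sinh (z - η / 2 - s l) /
      (sinh (z + η / 2 + s l) * sinh (z + η / 2 - s l))) *
    (qfun lv (z + η) / qfun lv (z - η))

theorem qfun_neg {M : ℕ} (lv : Fin M → ℂ) (z : ℂ) : qfun lv (-z) = qfun lv z := by
  refine Finset.prod_congr rfl fun l _ => ?_
  rw [show -z - lv l = -(z + lv l) by ring, show -z + lv l = -(z - lv l) by ring,
    sinh_neg, sinh_neg]
  ring

theorem qfun_ne_zero {M : ℕ} (lv : Fin M → ℂ) (z : ℂ)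
    (h : ∀ l, sinh (z - lv l) ≠ 0 ∧ sinh (z + lv l) ≠ 0) : qfun lv z ≠ 0 :=
  Finset.prod_ne_zero_iff.mpr fun l _ => mul_ne_zero (h l).1 (h l).2

theorem inhomogeneity_factor_mul_neg (η s z : ℂ)
    (h : sinh (z - η / 2 + s) ≠ 0 ∧ sinh (z - η / 2 - s) ≠ 0 ∧
      sinh (z + η / 2 + s) ≠ 0 ∧ sinh (z + η / 2 - s) ≠ 0) :
    (sinh (z - η / 2 + s) * sinh (z - η / 2 - s) /
      (sinh (z + η / 2 + s) * sinh (z + η / 2 - s))) *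
    (sinh (-z - η / 2 + s) * sinh (-z - η / 2 - s) /
      (sinh (-z + η / 2 + s) * sinh (-z + η / 2 - s))) = 1 := by
  obtain ⟨h1, h2, h3, h4⟩ := h
  rw [show -z - η / 2 + s = -(z + η / 2 - s) by ring,
    show -z - η / 2 - s = -(z + η / 2 + s) by ring,
    show -z + η / 2 + s = -(z - η / 2 - s) by ring,
    show -z + η / 2 - s = -(z - η / 2 + s) by ring]
  simp only [sinh_neg, neg_mul_neg]
  rw [mul_comm (sinh (z + η / 2 - s)), mul_comm (sinh (z - η / 2 - s)) (sinh (z - η / 2 + s)),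
    div_mul_div_cancel₀ (mul_ne_zero h3 h4), div_self (mul_ne_zero h1 h2)]

theorem boundary_factor_mul_neg (η ξp ξm z : ℂ)
    (h1 : sinh (z - ξp + η / 2) ≠ 0) (h2 : sinh (z + ξp - η / 2) ≠ 0)
    (h3 : sinh (z - ξm + η / 2) ≠ 0) (h4 : sinh (z + ξm - η / 2) ≠ 0) :
    (sinh (z - ξp + η / 2) * sinh (z - ξm + η / 2) /
      (sinh (z + ξp - η / 2) * sinh (z + ξm - η / 2))) *
    (sinh (-z - ξp + η / 2) * sinh (-z - ξm + η / 2) /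
      (sinh (-z + ξp - η / 2) * sinh (-z + ξm - η / 2))) = 1 := by
  rw [show -z - ξp + η / 2 = -(z + ξp - η / 2) by ring,
    show -z - ξm + η / 2 = -(z + ξm - η / 2) by ring,
    show -z + ξp - η / 2 = -(z - ξp + η / 2) by ring,
    show -z + ξm - η / 2 = -(z - ξm + η / 2) by ring]
  simp only [sinh_neg, neg_mul_neg]
  rw [div_mul_div_cancel₀ (mul_ne_zero h2 h4), div_self (mul_ne_zero h1 h3)]

theorem sinh_ratio_mul_neg (η z : ℂ)
    (h1 : sinh (2 * z - η) ≠ 0) (h2 : sinh (2 * z + η) ≠ 0) :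
    (sinh (2 * z - η) / sinh (2 * z + η)) *
      (sinh (2 * -z - η) / sinh (2 * -z + η)) = 1 := by
  rw [show 2 * -z - η = -(2 * z + η) by ring, show 2 * -z + η = -(2 * z - η) by ring]
  simp only [sinh_neg]
  field_simp

theorem qfun_ratio_mul_neg (η : ℂ) {M : ℕ} (lv : Fin M → ℂ) (z : ℂ)
    (h1 : qfun lv (z + η) ≠ 0) (h2 : qfun lv (z - η) ≠ 0) :
    (qfun lv (z + η) / qfun lv (z - η)) *
      (qfun lv (-z + η) / qfun lv (-z - η)) = 1 := by
  rw [show -z + η = -(z - η) by ring, show -z - η = -(z + η) by ring, qfun_neg, qfun_neg]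
  field_simp

theorem auxA_mul_auxA_neg (η ξp ξm : ℂ) {L M : ℕ} (s : Fin L → ℂ) (lv : Fin M → ℂ)
    (z : ℂ)
    (h1 : sinh (z - ξp + η / 2) ≠ 0) (h2 : sinh (z + ξp - η / 2) ≠ 0)
    (h3 : sinh (z - ξm + η / 2) ≠ 0) (h4 : sinh (z + ξm - η / 2) ≠ 0)
    (h5 : sinh (2 * z - η) ≠ 0) (h6 : sinh (2 * z + η) ≠ 0)
    (h7 : ∀ l, sinh (z - η / 2 + s l) ≠ 0 ∧ sinh (z - η / 2 - s l) ≠ 0 ∧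
      sinh (z + η / 2 + s l) ≠ 0 ∧ sinh (z + η / 2 - s l) ≠ 0)
    (h8 : ∀ l, sinh (z + η - lv l) ≠ 0 ∧ sinh (z + η + lv l) ≠ 0 ∧
      sinh (z - η - lv l) ≠ 0 ∧ sinh (z - η + lv l) ≠ 0) :
    auxA η ξp ξm s lv z * auxA η ξp ξm s lv (-z) = 1 := by
  have hb := boundary_factor_mul_neg η ξp ξm z h1 h2 h3 h4
  have hr := sinh_ratio_mul_neg η z h5 h6
  have hs := Finset.prod_eq_one fun l (_ : l ∈ Finset.univ) =>
    inhomogeneity_factor_mul_neg η (s l) z (h7 l)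
  have hq := qfun_ratio_mul_neg η lv z
    (qfun_ne_zero lv _ fun l => ⟨(h8 l).1, (h8 l).2.1⟩)
    (qfun_ne_zero lv _ fun l => (h8 l).2.2)
  rw [Finset.prod_mul_distrib] at hs
  unfold auxA
  rw [mul_mul_mul_comm, hq, mul_one, mul_mul_mul_comm, hs, mul_one, mul_mul_mul_comm, hb, hr,
    mul_one]

/-- `𝔞(z)·𝔞(−z) = 1`, provided all hyperbolic sine factors occurring in the
numerators and denominators of `𝔞(z)` and `𝔞(−z)` are nonzero. In particular the
solutions of `1 + 𝔞 = 0` are symmetric with respect to the origin. -/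
theorem aux_inversion (η ξp ξm : ℂ) {L M : ℕ} (s : Fin L → ℂ) (lv : Fin M → ℂ)
    (z : ℂ)
    (h1 : sinh (z - ξp + η / 2) ≠ 0) (h2 : sinh (z + ξp - η / 2) ≠ 0)
    (h3 : sinh (z - ξm + η / 2) ≠ 0) (h4 : sinh (z + ξm - η / 2) ≠ 0)
    (h5 : sinh (2 * z - η) ≠ 0) (h6 : sinh (2 * z + η) ≠ 0)
    (h7 : ∀ l, sinh (z - η / 2 + s l) ≠ 0 ∧ sinh (z - η / 2 - s l) ≠ 0 ∧
      sinh (z + η / 2 + s l) ≠ 0 ∧ sinh (z + η / 2 - s l) ≠ 0)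
    (h8 : ∀ l, sinh (z + η - lv l) ≠ 0 ∧ sinh (z + η + lv l) ≠ 0 ∧
      sinh (z - η - lv l) ≠ 0 ∧ sinh (z - η + lv l) ≠ 0) :
    auxA η ξp ξm s lv z * auxA η ξp ξm s lv (-z) = 1 ∧
    (1 + auxA η ξp ξm s lv z = 0 → 1 + auxA η ξp ξm s lv (-z) = 0) := by
  have hmul := auxA_mul_auxA_neg η ξp ξm s lv z h1 h2 h3 h4 h5 h6 h7 h8
  refine ⟨hmul, fun h => ?_⟩
  rw [eq_neg_of_add_eq_zero_right h] at hmul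
  linear_combination -hmul
end

section
/- For every j ∈ {1,…,M} and every z ∈ ℂ at which all occurring denominators are nonzero, the ratio identity y_j(−z)/y_j(z) = 𝔞(z) · (sinh(2z+η)/sinh(2z−η)) · (sinh(z+λ_j−η)·sinh(z−λ_j−η)) / (sinh(z+λ_j+η)·sinh(z−λ_j+η)) holds. Consequently, if in addition sinh(2λ_j+η) ≠ 0, sinh(2λ_j−η) ≠ 0, sinh η ≠ 0 and y_j(λ_j) ≠ 0, then the Bethe ansatz equation 1 + 𝔞(λ_j) = 0 holds if and only if y_j(λ_j) = y_j(−λ_j). -/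
open Complex

/-- `ŷ(z) = a(z−η/2)·d(−z−η/2)·sinh(z+ξ⁺−η/2)·sinh(z+ξ⁻−η/2)·
∏_{l=1}^M sinh(z−λ_l−η)·sinh(z+λ_l−η)`. -/
noncomputable def yhat (η ξp ξm : ℂ) {L M : ℕ} (s : Fin L → ℂ) (lv : Fin M → ℂ)
    (z : ℂ) : ℂ :=
  afun η s (z - η / 2) * dfun s (-z - η / 2) * sinh (z + ξp - η / 2) *
    sinh (z + ξm - η / 2) * ∏ l, sinh (z - lv l - η) * sinh (z + lv l - η)

/-- `y_j(z) = ŷ(z) / (sinh(z−λ_j−η)·sinh(z+λ_j−η))`. -/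
noncomputable def yfun (η ξp ξm : ℂ) {L M : ℕ} (s : Fin L → ℂ) (lv : Fin M → ℂ)
    (j : Fin M) (z : ℂ) : ℂ :=
  yhat η ξp ξm s lv z / (sinh (z - lv j - η) * sinh (z + lv j - η))

/-- Reflecting `ŷ` multiplies it by `𝔞(z)·sinh(2z+η)/sinh(2z−η)`. -/
theorem yhat_neg (η ξp ξm : ℂ) {L M : ℕ} (s : Fin L → ℂ) (lv : Fin M → ℂ) (z : ℂ)
    (hp : sinh (z + ξp - η / 2) ≠ 0) (hm : sinh (z + ξm - η / 2) ≠ 0)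
    (h2p : sinh (2 * z + η) ≠ 0) (h2m : sinh (2 * z - η) ≠ 0)
    (hs : ∀ l, sinh (z + η / 2 + s l) ≠ 0 ∧ sinh (z + η / 2 - s l) ≠ 0)
    (hl : ∀ l, sinh (z - η - lv l) ≠ 0 ∧ sinh (z - η + lv l) ≠ 0) :
    yhat η ξp ξm s lv (-z) =
      auxA η ξp ξm s lv z * (sinh (2 * z + η) / sinh (2 * z - η)) * yhat η ξp ξm s lv z := by
  have hbulk : afun η s (-z - η / 2) * dfun s (-(-z) - η / 2) =
      (∏ l, sinh (z - η / 2 + s l) * sinh (z - η / 2 - s l) /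
        (sinh (z + η / 2 + s l) * sinh (z + η / 2 - s l))) *
      (afun η s (z - η / 2) * dfun s (-z - η / 2)) := by
    simp only [afun, dfun, ← Finset.prod_mul_distrib]
    refine Finset.prod_congr rfl fun l _ => ?_
    obtain ⟨h1, h2⟩ := hs l
    rw [show -z - η / 2 - s l + η = -(z - η / 2 + s l) by ring,
      show - -z - η / 2 - s l = z - η / 2 - s l by ring,
      show z - η / 2 - s l + η = z + η / 2 - s l by ring,
      show -z - η / 2 - s l = -(z + η / 2 + s l) by ring, sinh_neg, sinh_neg]
    generalize sinh (z + η / 2 + s l) = b at *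
    generalize sinh (z + η / 2 - s l) = c at *
    generalize sinh (z - η / 2 + s l) = e
    generalize sinh (z - η / 2 - s l) = f
    field_simp
  have hnum : ∏ l, sinh (-z - lv l - η) * sinh (-z + lv l - η) = qfun lv (z + η) := by
    refine Finset.prod_congr rfl fun l _ => ?_
    rw [show -z - lv l - η = -(z + η + lv l) by ring,
      show -z + lv l - η = -(z + η - lv l) by ring, sinh_neg, sinh_neg]
    ring
  have hden : ∏ l, sinh (z - lv l - η) * sinh (z + lv l - η) = qfun lv (z - η) := by
    refine Finset.prod_congr rfl fun l _ => ?_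
    rw [sub_right_comm, add_sub_right_comm]
  have hq : qfun lv (z - η) ≠ 0 :=
    Finset.prod_ne_zero_iff.mpr fun l _ => mul_ne_zero (hl l).1 (hl l).2
  have hbp : sinh (-z + ξp - η / 2) = -sinh (z - ξp + η / 2) := by
    rw [← sinh_neg]; ring_nf
  have hbm : sinh (-z + ξm - η / 2) = -sinh (z - ξm + η / 2) := by
    rw [← sinh_neg]; ring_nf
  rw [yhat, yhat, auxA, hbulk, hnum, hden, hbp, hbm]
  clear hbulk hnum hden hbp hbm hs
  generalize sinh (z + ξp - η / 2) = bp at *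
  generalize sinh (z + ξm - η / 2) = bm at *
  generalize sinh (z - ξp + η / 2) = cp
  generalize sinh (z - ξm + η / 2) = cm
  generalize afun η s (z - η / 2) * dfun s (-z - η / 2) = k
  generalize sinh (2 * z + η) = tp at *
  generalize sinh (2 * z - η) = tm at *
  field_simp

/-- The reflection ratio of `y_j`, wherever all denominators are nonzero. -/
theorem yfun_neg_div (η ξp ξm : ℂ) {L M : ℕ} (s : Fin L → ℂ) (lv : Fin M → ℂ)
    (j : Fin M) (z : ℂ)
    (hp : sinh (z + ξp - η / 2) ≠ 0) (hm : sinh (z + ξm - η / 2) ≠ 0)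
    (h2p : sinh (2 * z + η) ≠ 0) (h2m : sinh (2 * z - η) ≠ 0)
    (hs : ∀ l, sinh (z + η / 2 + s l) ≠ 0 ∧ sinh (z + η / 2 - s l) ≠ 0)
    (hl : ∀ l, sinh (z - η - lv l) ≠ 0 ∧ sinh (z - η + lv l) ≠ 0)
    (hy : yfun η ξp ξm s lv j z ≠ 0) :
    yfun η ξp ξm s lv j (-z) / yfun η ξp ξm s lv j z =
      auxA η ξp ξm s lv z * (sinh (2 * z + η) / sinh (2 * z - η)) *
        (sinh (z + lv j - η) * sinh (z - lv j - η)) /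
        (sinh (z + lv j + η) * sinh (z - lv j + η)) := by
  have hm' : sinh (-z - lv j - η) = -sinh (z + lv j + η) := by
    rw [← sinh_neg]; ring_nf
  have hp' : sinh (-z + lv j - η) = -sinh (z - lv j + η) := by
    rw [← sinh_neg]; ring_nf
  rw [yfun, div_ne_zero_iff, mul_ne_zero_iff] at hy
  obtain ⟨hy, h1, h2⟩ := hy
  rw [yfun, yfun, yhat_neg η ξp ξm s lv z hp hm h2p h2m hs hl, hm', hp', neg_mul_neg]
  generalize auxA η ξp ξm s lv z * (sinh (2 * z + η) / sinh (2 * z - η)) = A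
  field_simp

/-- The ratio identity
`y_j(−z)/y_j(z) = 𝔞(z)·(sinh(2z+η)/sinh(2z−η))·
(sinh(z+λ_j−η)·sinh(z−λ_j−η))/(sinh(z+λ_j+η)·sinh(z−λ_j+η))`
(valid wherever all occurring denominators are nonzero), and the consequent
reformulation of the Bethe ansatz equation `1 + 𝔞(λ_j) = 0` as
`y_j(λ_j) = y_j(−λ_j)`. -/
theorem yratio_and_BAE (η ξp ξm : ℂ) {L M : ℕ} (s : Fin L → ℂ) (lv : Fin M → ℂ)
    (j : Fin M) :
    (∀ z : ℂ,
      sinh (z + ξp - η / 2) ≠ 0 → sinh (z + ξm - η / 2) ≠ 0 →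
      sinh (2 * z + η) ≠ 0 → sinh (2 * z - η) ≠ 0 →
      (∀ l, sinh (z + η / 2 + s l) ≠ 0 ∧ sinh (z + η / 2 - s l) ≠ 0) →
      (∀ l, sinh (z - η - lv l) ≠ 0 ∧ sinh (z - η + lv l) ≠ 0) →
      sinh (z - lv j - η) ≠ 0 → sinh (z + lv j - η) ≠ 0 →
      sinh (z - lv j + η) ≠ 0 → sinh (z + lv j + η) ≠ 0 →
      yfun η ξp ξm s lv j z ≠ 0 →
      yfun η ξp ξm s lv j (-z) / yfun η ξp ξm s lv j z =
        auxA η ξp ξm s lv z * (sinh (2 * z + η) / sinh (2 * z - η)) *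
          (sinh (z + lv j - η) * sinh (z - lv j - η)) /
          (sinh (z + lv j + η) * sinh (z - lv j + η))) ∧
    (sinh (2 * lv j + η) ≠ 0 → sinh (2 * lv j - η) ≠ 0 → sinh η ≠ 0 →
      yfun η ξp ξm s lv j (lv j) ≠ 0 →
      sinh (lv j + ξp - η / 2) ≠ 0 → sinh (lv j + ξm - η / 2) ≠ 0 →
      (∀ l, sinh (lv j + η / 2 + s l) ≠ 0 ∧ sinh (lv j + η / 2 - s l) ≠ 0) →
      (∀ l, sinh (lv j - η - lv l) ≠ 0 ∧ sinh (lv j - η + lv l) ≠ 0) →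
      (1 + auxA η ξp ξm s lv (lv j) = 0 ↔
        yfun η ξp ξm s lv j (lv j) = yfun η ξp ξm s lv j (-lv j))) := by
  refine ⟨fun z hp hm h2p h2m hs hl _ _ _ _ hy =>
    yfun_neg_div η ξp ξm s lv j z hp hm h2p h2m hs hl hy, ?_⟩
  intro h2p h2m hη hy hp hm hs hl
  have hratio := yfun_neg_div η ξp ξm s lv j (lv j) hp hm h2p h2m hs hl hy
  rw [← two_mul, sub_self, zero_sub, zero_add, sinh_neg] at hratio
  have hneg : yfun η ξp ξm s lv j (-lv j) =
      -auxA η ξp ξm s lv (lv j) * yfun η ξp ξm s lv j (lv j) := by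
    rw [← div_eq_iff hy, hratio]
    field_simp
  rw [hneg, eq_comm (a := yfun η ξp ξm s lv j (lv j)), mul_eq_right₀ hy, neg_eq_iff_eq_neg,
    add_comm, add_eq_zero_iff_eq_neg]
end

section
/- Fix λ_j, λ_k ∈ ℂ with sinh η ≠ 0, sinh(2λ_j) ≠ 0 and sinh(λ_j+λ_k+η), sinh(λ_j+λ_k−η), sinh(λ_j−λ_k+η), sinh(λ_j−λ_k−η) all nonzero, and suppose 𝔞 is holomorphic in a neighborhood of λ_k with 𝔞(λ_k) = −1. Define E(μ) = (1/(sinh(λ_j+μ)·sinh(λ_j−μ))) · [ sinh(2μ−η)/(sinh(μ+λ_j−η)·sinh(μ−λ_j−η)) − 𝔞(μ)·sinh(2μ+η)/(sinh(μ+λ_j+η)·sinh(μ−λ_j+η)) ]. Then: (i) if sinh(λ_j−λ_k) ≠ 0 and sinh(λ_j+λ_k) ≠ 0, E(λ_k) = (1/(sinh η · sinh 2λ_j)) · [ i·K_η(λ_j+λ_k) − i·K_η(λ_j−λ_k) ]; (ii) if λ_k = λ_j, then lim_{μ→λ_j, μ≠λ_j} E(μ) = (1/(sinh η · sinh 2λ_j))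 · [ i·K_η(2λ_j) − i·K_η(0) − 𝔞′(λ_j)/𝔞(λ_j) ]. -/
open Complex Filter

/-- The kernel `K_η(λ) = (1/i) · sinh(2η) / (sinh(λ+η)·sinh(λ−η))`. -/
noncomputable def Kker (η lam : ℂ) : ℂ :=
  (1 / I) * (sinh (2 * η) / (sinh (lam + η) * sinh (lam - η)))

/-- The function whose limit `μ → λ_k` is considered in the determinant entries. -/
noncomputable def Efun (η lamj : ℂ) (a : ℂ → ℂ) (μ : ℂ) : ℂ :=
  (1 / (sinh (lamj + μ) * sinh (lamj - μ))) *
    (sinh (2 * μ - η) / (sinh (μ + lamj - η) * sinh (μ - lamj - η)) -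
      a μ * (sinh (2 * μ + η) / (sinh (μ + lamj + η) * sinh (μ - lamj + η))))

/-- Product identity behind the partial-fraction form of the determinant entries. -/
theorem sinh_triple_product (u v η : ℂ) :
    sinh (u + v - η) * (sinh (u + η) * sinh (v + η)) +
      sinh (u + v + η) * (sinh (u - η) * sinh (v - η)) =
      2 * cosh η * sinh (u + v) * (sinh u * sinh v) := by
  simp only [sinh, cosh, sub_eq_add_neg, neg_add, neg_neg, exp_add, exp_neg]
  field_simp
  ring

theorem sinh_product_sub (u v η : ℂ) :
    sinh (u + η) * sinh (u - η) - sinh (v + η) * sinh (v - η) =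
      sinh (u - v) * sinh (u + v) := by
  simp only [sinh, sub_eq_add_neg, neg_add, neg_neg, exp_add, exp_neg]
  field_simp
  ring

theorem sinh_partial_fraction {u v η : ℂ} (hη : sinh η ≠ 0) (huv : sinh (u - v) ≠ 0)
    (hu : sinh u ≠ 0) (hv : sinh v ≠ 0)
    (hup : sinh (u + η) ≠ 0) (hum : sinh (u - η) ≠ 0)
    (hvp : sinh (v + η) ≠ 0) (hvm : sinh (v - η) ≠ 0) :
    (1 / (sinh u * -sinh v)) *
      (sinh (u + v - η) / (sinh (u - η) * sinh (v - η)) +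
        sinh (u + v + η) / (sinh (u + η) * sinh (v + η))) =
      (1 / (sinh η * sinh (u - v))) *
        (sinh (2 * η) / (sinh (u + η) * sinh (u - η)) -
          sinh (2 * η) / (sinh (v + η) * sinh (v - η))) := by
  have h₁ := sinh_triple_product u v η
  have h₂ := sinh_product_sub u v η
  rw [div_add_div _ _ (mul_ne_zero hum hvm) (mul_ne_zero hup hvp),
    div_sub_div _ _ (mul_ne_zero hup hum) (mul_ne_zero hvp hvm),
    mul_comm (sinh (u - η) * sinh (v - η)), h₁, ← mul_comm (sinh (2 * η)), ← mul_sub,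
    ← neg_sub (sinh (u + η) * _), h₂, sinh_two_mul]
  field_simp

theorem I_mul_Kker (η lam : ℂ) :
    I * Kker η lam = sinh (2 * η) / (sinh (lam + η) * sinh (lam - η)) := by
  rw [Kker, ← mul_assoc, mul_one_div_cancel I_ne_zero, one_mul]

/-- Splitting of `Efun` into its value for `a μ = -1` and the deviation of `a μ` from `-1`. -/
theorem Efun_eq {η lamj μ : ℂ} (a : ℂ → ℂ) (hη : sinh η ≠ 0) (h2l : sinh (2 * lamj) ≠ 0)
    (hp : sinh (lamj + μ) ≠ 0) (hm : sinh (lamj - μ) ≠ 0)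
    (hpp : sinh (lamj + μ + η) ≠ 0) (hpm : sinh (lamj + μ - η) ≠ 0)
    (hmp : sinh (lamj - μ + η) ≠ 0) (hmm : sinh (lamj - μ - η) ≠ 0) :
    Efun η lamj a μ =
      (1 / (sinh η * sinh (2 * lamj))) *
          (I * Kker η (lamj + μ) - I * Kker η (lamj - μ)) -
        (a μ + 1) / sinh (lamj - μ) *
          (sinh (2 * μ + η) /
            (sinh (lamj + μ) * (sinh (μ + lamj + η) * sinh (μ - lamj + η)))) := by
  have e₁ : sinh (lamj - μ) = -sinh (μ - lamj) := by rw [← sinh_neg, neg_sub]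
  have e₂ : sinh (lamj - μ + η) = -sinh (μ - lamj - η) := by rw [← sinh_neg]; ring_nf
  have e₃ : sinh (lamj - μ - η) = -sinh (μ - lamj + η) := by rw [← sinh_neg]; ring_nf
  rw [e₁, neg_ne_zero] at hm
  rw [e₂, neg_ne_zero] at hmp
  rw [e₃, neg_ne_zero] at hmm
  have key := sinh_partial_fraction (u := lamj + μ) (v := μ - lamj) hη
    (by rwa [show lamj + μ - (μ - lamj) = 2 * lamj by ring]) hp hm hpp hpm hmm hmp
  rw [show lamj + μ - (μ - lamj) = 2 * lamj by ring,
    show lamj + μ + (μ - lamj) = 2 * μ by ring] at key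
  rw [I_mul_Kker, I_mul_Kker, Efun, e₂, e₃, neg_mul_neg, mul_comm (sinh (μ - lamj - η)), ← key,
    e₁, add_comm μ lamj]
  have : sinh (μ - lamj + η) * sinh (μ - lamj - η) ≠ 0 := mul_ne_zero hmm hmp
  field_simp
  ring

/-- If `a x = -1`, the quotient `(a μ + 1) / sinh (x - μ)` tends to `-a′(x)` as `μ → x`. -/
theorem tendsto_add_one_div_sinh {a : ℂ → ℂ} {x : ℂ} (ha : DifferentiableAt ℂ a x)
    (hx : a x = -1) :
    Tendsto (fun μ => (a μ + 1) / sinh (x - μ)) (nhdsWithin x {x}ᶜ) (nhds (-deriv a x)) := by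
  have hs : HasDerivAt (fun μ => sinh (x - μ)) (-1) x := by
    simpa using ((hasDerivAt_id x).const_sub x).csinh
  have h := ha.hasDerivAt.tendsto_slope.div hs.tendsto_slope (by norm_num)
  rw [div_neg, div_one] at h
  refine h.congr' ?_
  filter_upwards [self_mem_nhdsWithin] with μ hμ
  have hμ' : μ - x ≠ 0 := sub_ne_zero.mpr hμ
  simp only [Pi.div_apply, slope_def_field, hx, sub_self, sinh_zero, sub_zero, sub_neg_eq_add]
  exact div_div_div_cancel_right₀ hμ' _ _

/-- Evaluation of the determinant entries through the kernel `K_η`: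
(i) at `λ_k ≠ ±λ_j` the value of `E`, and (ii) for `λ_k = λ_j` the limit `μ → λ_j`,
which picks up the logarithmic derivative `𝔞′(λ_j)/𝔞(λ_j)` of the auxiliary
function. -/
theorem det_entry_limit (η lamj lamk : ℂ) (a : ℂ → ℂ)
    (hη : sinh η ≠ 0) (h2l : sinh (2 * lamj) ≠ 0)
    (hpp : sinh (lamj + lamk + η) ≠ 0) (hpm : sinh (lamj + lamk - η) ≠ 0)
    (hmp : sinh (lamj - lamk + η) ≠ 0) (hmm : sinh (lamj - lamk - η) ≠ 0)
    (han : AnalyticAt ℂ a lamk) (hval : a lamk = -1) :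
    ((sinh (lamj - lamk) ≠ 0 → sinh (lamj + lamk) ≠ 0 →
      Efun η lamj a lamk =
        (1 / (sinh η * sinh (2 * lamj))) *
          (I * Kker η (lamj + lamk) - I * Kker η (lamj - lamk)))) ∧
    (lamk = lamj →
      Tendsto (Efun η lamj a) (nhdsWithin lamj {lamj}ᶜ)
        (nhds ((1 / (sinh η * sinh (2 * lamj))) *
          (I * Kker η (2 * lamj) - I * Kker η 0 - deriv a lamj / a lamj)))) := by
  refine ⟨fun hm hp => ?_, ?_⟩
  · rw [Efun_eq a hη h2l hp hm hpp hpm hmp hmm, hval]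
    simp
  · rintro rfl
    have hs : HasDerivAt (fun μ => sinh (lamk - μ)) (-1) lamk := by
      simpa using ((hasDerivAt_id lamk).const_sub lamk).csinh
    have hm : ∀ᶠ μ in nhdsWithin lamk {lamk}ᶜ, sinh (lamk - μ) ≠ 0 :=
      hs.eventually_ne (by norm_num)
    have ev : ∀ {f : ℂ → ℂ}, Continuous f → f lamk ≠ 0 →
        ∀ᶠ μ in nhdsWithin lamk {lamk}ᶜ, f μ ≠ 0 := fun hf h0 =>
      (hf.continuousAt.eventually_ne h0).filter_mono nhdsWithin_le_nhds
    have hsum : sinh (lamk + lamk) ≠ 0 := by rwa [← two_mul]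
    have hlim : ContinuousAt (fun μ => (1 / (sinh η * sinh (2 * lamk))) *
        (I * Kker η (lamk + μ) - I * Kker η (lamk - μ))) lamk := by
      simp only [I_mul_Kker]
      have h₁ := mul_ne_zero hpp hpm
      have h₂ := mul_ne_zero hmp hmm
      fun_prop (disch := assumption)
    have hrest : ContinuousAt (fun μ => sinh (2 * μ + η) /
        (sinh (lamk + μ) * (sinh (μ + lamk + η) * sinh (μ - lamk + η)))) lamk := by
      have h := mul_ne_zero hsum (mul_ne_zero hpp hmp)
      fun_prop (disch := assumption)
    have h := (hlim.tendsto.mono_left nhdsWithin_le_nhds).sub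
      ((tendsto_add_one_div_sinh han.differentiableAt hval).mul
        (hrest.tendsto.mono_left nhdsWithin_le_nhds))
    have hval' : (1 / (sinh η * sinh (2 * lamk))) *
          (I * Kker η (2 * lamk) - I * Kker η 0 - deriv a lamk / a lamk) =
        (1 / (sinh η * sinh (2 * lamk))) *
          (I * Kker η (lamk + lamk) - I * Kker η (lamk - lamk)) -
        -deriv a lamk * (sinh (2 * lamk + η) /
          (sinh (lamk + lamk) * (sinh (lamk + lamk + η) * sinh (lamk - lamk + η)))) := by
      rw [hval, ← two_mul, sub_self, zero_add]
      rw [← two_mul] at hpp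
      field_simp
    rw [hval']
    refine h.congr' ?_
    filter_upwards [hm, ev (f := fun μ => sinh (lamk + μ)) (by fun_prop) hsum,
      ev (f := fun μ => sinh (lamk + μ + η)) (by fun_prop) hpp,
      ev (f := fun μ => sinh (lamk + μ - η)) (by fun_prop) hpm,
      ev (f := fun μ => sinh (lamk - μ + η)) (by fun_prop) hmp,
      ev (f := fun μ => sinh (lamk - μ - η)) (by fun_prop) hmm] with μ h₁ h₂ h₃ h₄ h₅ h₆
    exact (Efun_eq a hη h2l h₂ h₁ h₃ h₄ h₅ h₆).symm
end
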